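/- Let p ≥ 2 be an integer and 𝔭 = ⌊(p+1)/2⌋. Then: (i) for every integer k ≥ 𝔭, 𝔖_k^p > pπ/2; and (ii) for every integer k ≥ 2𝔭, 𝔖_k^p ≥ (⌊k/𝔭⌋ − 1/2)·pπ. (Theorem 4.8(i),(ii) of the paper.) -/

import Mathlib

open Set MeasureTheory Metric Filter Asymptotics
open scoped ENNReal Topology NNReal

noncomputable section

abbrev E2 : Type := EuclideanSpace ℝ (Fin 2)

def IsLipschitzDomain (Ω : Set E2) : Prop :=
  IsOpen Ω ∧ IsConnected Ω ∧ Bornology.IsBounded Ω ∧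
    ∀ p ∈ frontier Ω, ∃ (e : E2 ≃ₗᵢ[ℝ] E2) (K : ℝ≥0) (φ : ℝ → ℝ) (U : Set E2),
      LipschitzWith K φ ∧ IsOpen U ∧ p ∈ U ∧
      ∀ x ∈ U, (x ∈ Ω ↔ φ (e x 0) < e x 1)

def dirEnergy (Ω : Set E2) (f : E2 → ℝ) : ℝ≥0∞ :=
  ∫⁻ x in Ω, (‖fderiv ℝ f x‖₊ : ℝ≥0∞) ^ 2

def bdryInt (Γ : Set E2) (ρ f : E2 → ℝ) : ℝ≥0∞ :=
  ∫⁻ x in Γ, ENNReal.ofReal (ρ x * (f x) ^ 2) ∂μH[1]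

def rayleigh (Ω Γ : Set E2) (ρ f : E2 → ℝ) : ℝ≥0∞ :=
  dirEnergy Ω f / bdryInt Γ ρ f

def steklovMixed (Ω ΓS ΓD : Set E2) (ρ : E2 → ℝ) (k : ℕ) : ℝ≥0∞ :=
  ⨅ (V : Submodule ℝ (E2 → ℝ))
    (_ : Module.finrank ℝ V = k + 1)
    (_ : ∀ f ∈ V, ContDiff ℝ (⊤ : ℕ∞) f)
    (_ : ∀ f ∈ V, ∀ᶠ x in nhdsSet ΓD, f x = 0)
    (_ : ∀ f ∈ V, Set.EqOn f 0 (closure Ω) → f = 0),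
    ⨆ f ∈ V, ⨆ (_ : ¬ Set.EqOn f 0 (closure Ω)), rayleigh Ω ΓS ρ f

def steklovN (Ω ΓS : Set E2) (k : ℕ) : ℝ≥0∞ :=
  steklovMixed Ω ΓS ∅ (fun _ => 1) k

def steklovD (Ω ΓS ΓD : Set E2) (k : ℕ) : ℝ≥0∞ :=
  steklovMixed Ω ΓS ΓD (fun _ => 1) k

def steklovW (Ω : Set E2) (ρ : E2 → ℝ) (k : ℕ) : ℝ≥0∞ :=
  steklovMixed Ω (frontier Ω) ∅ ρ k

def steklov (Ω : Set E2) (k : ℕ) : ℝ≥0∞ := steklovW Ω (fun _ => 1) k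

def IsArc (A : Set E2) : Prop :=
  ∃ γ : ℝ → E2, ContinuousOn γ (Icc 0 1) ∧ InjOn γ (Icc 0 1) ∧ A = γ '' Icc 0 1

def IsLoop (A : Set E2) : Prop :=
  ∃ γ : ℝ → E2, ContinuousOn γ (Icc 0 1) ∧ InjOn γ (Ico 0 1) ∧ γ 0 = γ 1 ∧ A = γ '' Icc 0 1

def IsBoundaryPart (Γ : Set E2) : Prop :=
  ∃ F : Finset (Set E2), (∀ A ∈ F, IsArc A ∨ IsLoop A) ∧ Γ = ⋃₀ ↑F

structure SteklovDecomp (Ω ΓS Γstar : Set E2) : Prop where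
  partS : IsBoundaryPart ΓS
  partStar : IsBoundaryPart Γstar
  union_eq : ΓS ∪ Γstar = frontier Ω
  inter_finite : (ΓS ∩ Γstar).Finite
  nonemptyS : ΓS.Nonempty

/-- Rotation of the plane by angle θ about the origin. -/
def rotBy (θ : ℝ) : E2 → E2 := fun x =>
  (WithLp.equiv 2 (Fin 2 → ℝ)).symm
    ![Real.cos θ * x 0 - Real.sin θ * x 1, Real.sin θ * x 0 + Real.cos θ * x 1]

/-- The reflection τ(x,y) = (x,−y). -/
def reflX : E2 → E2 := fun x => (WithLp.equiv 2 (Fin 2 → ℝ)).symm ![x 0, -(x 1)]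

/-- The class 𝔇_p of half-domains Ω = Ω̃ ∩ {y > 0}, encoded by the ambient domain Ω̃:
Ω̃ is a simply connected bounded Lipschitz planar domain invariant under rotation by
2π/p about the origin and under the reflection (x,y) ↦ (x,−y), and Ω̃ ∩ {y = 0} is an
open interval symmetric about the origin. -/
def MemFrakDp (p : ℕ) (Ωt : Set E2) : Prop :=
  IsLipschitzDomain Ωt ∧ SimplyConnectedSpace Ωt ∧
  rotBy (2 * Real.pi / p) '' Ωt = Ωt ∧ reflX '' Ωt = Ωt ∧
  ∃ r : ℝ, 0 < r ∧ Ωt ∩ {x : E2 | x 1 = 0} = {x : E2 | x 1 = 0 ∧ -r < x 0 ∧ x 0 < r}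

/-- 𝔖_k^p: the supremum over Ω ∈ 𝔇_p of σ_k^N(Ω)·L(∂_SΩ), where Ω = Ω̃ ∩ {y>0},
∂_SΩ = ∂Ω̃ ∩ {y>0} and Neumann conditions are imposed on the diameter. -/
def SfrakP (p k : ℕ) : ℝ≥0∞ :=
  ⨆ (Ωt : Set E2) (_ : MemFrakDp p Ωt),
    steklovN (Ωt ∩ {x : E2 | 0 < x 1}) (frontier Ωt ∩ {x : E2 | 0 < x 1}) k
      * μH[1] (frontier Ωt ∩ {x : E2 | 0 < x 1})

lemma integral_sq_le_of_dirichlet {g g' : ℝ → ℝ} {a : ℝ}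
    (hg : ∀ x, HasDerivAt g (g' x) x) (hg' : Continuous g') (ha : g a = 0)
    (hb : g (a + Real.pi) = 0) :
    ∫ x in a..a + Real.pi, g x ^ 2 ≤ ∫ x in a..a + Real.pi, g' x ^ 2 := by
  have hpi := Real.pi_pos
  have hgc : Continuous g := continuous_iff_continuousAt.2 fun x => (hg x).continuousAt
  have key : ∀ l : ℝ, l ∈ Ioo (0 : ℝ) 1 →
      l ^ 2 * ∫ x in a..a + Real.pi, g x ^ 2 ≤ ∫ x in a..a + Real.pi, g' x ^ 2 := by
    rintro l ⟨hl0, hl1⟩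
    have hcos : ∀ x ∈ Icc a (a + Real.pi), Real.cos (l * (x - (a + Real.pi / 2))) ≠ 0 := by
      rintro x ⟨h1, h2⟩
      refine (Real.cos_pos_of_mem_Ioo ⟨?_, ?_⟩).ne' <;> nlinarith
    have huIcc : uIcc a (a + Real.pi) = Icc a (a + Real.pi) := uIcc_of_le (by linarith)
    have hder : ∀ x ∈ uIcc a (a + Real.pi), HasDerivAt
        (fun x => l * Real.tan (l * (x - (a + Real.pi / 2))) * g x ^ 2)
        ((g' x + l * Real.tan (l * (x - (a + Real.pi / 2))) * g x) ^ 2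
          - (g' x ^ 2 - l ^ 2 * g x ^ 2)) x := by
      intro x hx
      have hc := hcos x (huIcc ▸ hx)
      have h1 : HasDerivAt (fun x => l * (x - (a + Real.pi / 2))) l x := by
        simpa using ((hasDerivAt_id x).sub_const (a + Real.pi / 2)).const_mul l
      have h2 := (((Real.hasDerivAt_tan hc).comp x h1).const_mul l).mul ((hg x).pow 2)
      refine h2.congr_deriv ?_
      have h3 : 1 / Real.cos (l * (x - (a + Real.pi / 2))) ^ 2
          = 1 + Real.tan (l * (x - (a + Real.pi / 2))) ^ 2 := by
        rw [div_eq_iff (pow_ne_zero 2 hc), Real.one_add_tan_sq_mul_cos_sq_eq_one hc]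
      rw [h3]
      simp only [Function.comp, Pi.pow_apply]
      ring
    have hcont : ContinuousOn (fun x => g' x + l * Real.tan (l * (x - (a + Real.pi / 2))) * g x)
        (uIcc a (a + Real.pi)) := by
      refine hg'.continuousOn.add (ContinuousOn.mul (ContinuousOn.mul continuousOn_const ?_)
        hgc.continuousOn)
      intro x hx
      have h1 : ContinuousAt (fun x => l * (x - (a + Real.pi / 2))) x := by fun_prop
      exact ((Real.continuousAt_tan.2 (hcos x (huIcc ▸ hx))).comp_of_eq h1 rfl).continuousWithinAt
    have hi1 : IntervalIntegrable (fun x => (g' x + l * Real.tan (l * (x - (a + Real.pi / 2))) * g x) ^ 2)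
        volume a (a + Real.pi) := (hcont.pow 2).intervalIntegrable
    have hi2 : IntervalIntegrable (fun x => g' x ^ 2) volume a (a + Real.pi) :=
      (hg'.pow 2).intervalIntegrable _ _
    have hi3 : IntervalIntegrable (fun x => l ^ 2 * g x ^ 2) volume a (a + Real.pi) :=
      (continuous_const.mul (hgc.pow 2)).intervalIntegrable _ _
    have hFTC := intervalIntegral.integral_eq_sub_of_hasDerivAt hder (hi1.sub (hi2.sub hi3))
    rw [intervalIntegral.integral_sub hi1 (hi2.sub hi3), intervalIntegral.integral_sub hi2 hi3,
      intervalIntegral.integral_const_mul, ha, hb] at hFTC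
    have hpos : 0 ≤ ∫ x in a..a + Real.pi,
        (g' x + l * Real.tan (l * (x - (a + Real.pi / 2))) * g x) ^ 2 :=
      intervalIntegral.integral_nonneg (by linarith) fun x _ => sq_nonneg _
    linarith
  have hlim : Tendsto (fun l : ℝ => l ^ 2 * ∫ x in a..a + Real.pi, g x ^ 2) (𝓝[<] 1)
      (𝓝 (1 ^ 2 * ∫ x in a..a + Real.pi, g x ^ 2)) :=
    (((continuous_id.pow 2).mul continuous_const).tendsto 1).mono_left nhdsWithin_le_nhds
  rw [one_pow, one_mul] at hlim
  refine le_of_tendsto hlim ?_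
  filter_upwards [Ioo_mem_nhdsLT (show (0 : ℝ) < 1 by norm_num)] with l hl using key l hl

/-- Wirtinger's inequality with Neumann conditions on an interval of length `π`. -/
lemma wirtinger_neumann {g g' : ℝ → ℝ} (a : ℝ)
    (hg : ∀ x, HasDerivAt g (g' x) x) (hg' : Continuous g') :
    (∫ x in a..a + Real.pi, g x ^ 2) - (∫ x in a..a + Real.pi, g x) ^ 2 / Real.pi
      ≤ ∫ x in a..a + Real.pi, g' x ^ 2 := by
  have hpi := Real.pi_pos
  have hgc : Continuous g := continuous_iff_continuousAt.2 fun x => (hg x).continuousAt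
  set m := (∫ x in a..a + Real.pi, g x) / Real.pi with hm
  have hmI : ∫ x in a..a + Real.pi, g x = m * Real.pi := by rw [hm]; field_simp
  have hvc : Continuous fun x => g x - m := by fun_prop
  set G : ℝ → ℝ := fun x => ∫ t in a..x, (g t - m) with hG
  have hGd : ∀ x, HasDerivAt G (g x - m) x := fun x =>
    intervalIntegral.integral_hasDerivAt_right (hvc.intervalIntegrable _ _)
      (hvc.stronglyMeasurableAtFilter _ _) hvc.continuousAt
  have hGc : Continuous G := continuous_iff_continuousAt.2 fun x => (hGd x).continuousAt
  have hGa : G a = 0 := by simp [hG]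
  have hGb : G (a + Real.pi) = 0 := by
    simp only [hG]
    rw [intervalIntegral.integral_sub (hgc.intervalIntegrable _ _) (by simp), hmI]
    simp; ring
  have hD := integral_sq_le_of_dirichlet hGd hvc hGa hGb
  have hparts := intervalIntegral.integral_mul_deriv_eq_deriv_mul (a := a) (b := a + Real.pi)
    (u := g) (v := G) (u' := g') (v' := fun x => g x - m) (fun x _ => hg x) (fun x _ => hGd x)
    (hg'.intervalIntegrable _ _) (hvc.intervalIntegrable _ _)
  have i1 : IntervalIntegrable (fun x => (g x - m) ^ 2) volume a (a + Real.pi) :=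
    (hvc.pow 2).intervalIntegrable _ _
  have i2 : IntervalIntegrable (fun x => g' x ^ 2) volume a (a + Real.pi) :=
    (hg'.pow 2).intervalIntegrable _ _
  have i3 : IntervalIntegrable (fun x => G x ^ 2) volume a (a + Real.pi) :=
    (hGc.pow 2).intervalIntegrable _ _
  have i4 : IntervalIntegrable (fun x => g' x * G x) volume a (a + Real.pi) :=
    (hg'.mul hGc).intervalIntegrable _ _
  have i5 : IntervalIntegrable (fun x => g x * (g x - m)) volume a (a + Real.pi) :=
    (hgc.mul hvc).intervalIntegrable _ _
  have i6 : IntervalIntegrable (fun x => g x ^ 2) volume a (a + Real.pi) :=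
    (hgc.pow 2).intervalIntegrable _ _
  have i7 : IntervalIntegrable (fun x => m * g x) volume a (a + Real.pi) :=
    (continuous_const.mul hgc).intervalIntegrable _ _
  have e1 : ∫ x in a..a + Real.pi, g x * (g x - m)
      = (∫ x in a..a + Real.pi, g x ^ 2) - m ^ 2 * Real.pi := by
    rw [show (fun x => g x * (g x - m)) = fun x => g x ^ 2 - m * g x from funext fun x => by ring,
      intervalIntegral.integral_sub i6 i7, intervalIntegral.integral_const_mul, hmI]
    ring
  have e2 : ∫ x in a..a + Real.pi, (g x - m) ^ 2
      = (∫ x in a..a + Real.pi, g x ^ 2) - m ^ 2 * Real.pi := by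
    rw [show (fun x => (g x - m) ^ 2) = fun x => (g x ^ 2 - m * g x) - (m * g x - m ^ 2) from
      funext fun x => by ring, intervalIntegral.integral_sub (i6.sub i7) (i7.sub (by simp)),
      intervalIntegral.integral_sub i6 i7, intervalIntegral.integral_sub i7 (by simp),
      intervalIntegral.integral_const_mul, hmI]
    simp
    ring
  rw [hGa, hGb, e1] at hparts
  have hpos : 0 ≤ ∫ x in a..a + Real.pi, (g' x + G x) ^ 2 :=
    intervalIntegral.integral_nonneg (by linarith) fun x _ => sq_nonneg _
  rw [show (fun x => (g' x + G x) ^ 2) = fun x => (g' x ^ 2 + G x ^ 2) + 2 * (g' x * G x) from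
      funext fun x => by ring, intervalIntegral.integral_add (i2.add i3) (i4.const_mul 2),
      intervalIntegral.integral_add i2 i3, intervalIntegral.integral_const_mul] at hpos
  have : (∫ x in a..a + Real.pi, g x) ^ 2 / Real.pi = m ^ 2 * Real.pi := by
    rw [hmI]; field_simp
  rw [this]
  rw [e2] at hD
  linarith

/-- Wirtinger's inequality for `2π`-periodic functions. -/
lemma wirtinger_periodic {g g' : ℝ → ℝ}
    (hg : ∀ x, HasDerivAt g (g' x) x) (hg' : Continuous g')
    (hp : Function.Periodic g (2 * Real.pi)) :
    (∫ x in -Real.pi..Real.pi, g x ^ 2) - (∫ x in -Real.pi..Real.pi, g x) ^ 2 / (2 * Real.pi)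
      ≤ ∫ x in -Real.pi..Real.pi, g' x ^ 2 := by
  have hpi := Real.pi_pos
  have hgc : Continuous g := continuous_iff_continuousAt.2 fun x => (hg x).continuousAt
  have hp' : Function.Periodic g' (2 * Real.pi) := by
    intro x
    have h1 : HasDerivAt (fun x => g (x + 2 * Real.pi)) (g' (x + 2 * Real.pi)) x :=
      HasDerivAt.comp_add_const x _ (hg _)
    rw [show (fun x => g (x + 2 * Real.pi)) = g from funext hp] at h1
    exact h1.unique (hg x)
  obtain ⟨s, hs⟩ : ∃ s, g s - g (s + Real.pi) = 0 := by
    have hc : Continuous fun s => g s - g (s + Real.pi) := by fun_prop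
    have h0 : g (0 + Real.pi) - g (0 + Real.pi + Real.pi) = -(g 0 - g (0 + Real.pi)) := by
      have := hp 0
      rw [show (0 : ℝ) + Real.pi + Real.pi = 0 + 2 * Real.pi by ring, this]
      ring
    rcases le_total (g 0 - g (0 + Real.pi)) 0 with h | h
    · exact intermediate_value_univ 0 (0 + Real.pi) hc ⟨h, by linarith⟩
    · exact intermediate_value_univ (0 + Real.pi) 0 hc ⟨by linarith, h⟩
  have hvd : ∀ x, HasDerivAt (fun x => g x - g s) (g' x) x := fun x => (hg x).sub_const _
  have h1 := integral_sq_le_of_dirichlet (a := s) hvd hg' (by simp) (by linarith)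
  have h2 := integral_sq_le_of_dirichlet (a := s + Real.pi) hvd hg' (by linarith) (by
    rw [show s + Real.pi + Real.pi = s + 2 * Real.pi by ring, hp s]; ring)
  have hvc : Continuous fun x => (g x - g s) ^ 2 := by fun_prop
  have hwc : Continuous fun x => g' x ^ 2 := by fun_prop
  have a1 := intervalIntegral.integral_add_adjacent_intervals
    (hvc.intervalIntegrable (μ := volume) s (s + Real.pi))
    (hvc.intervalIntegrable (s + Real.pi) (s + Real.pi + Real.pi))
  have a2 := intervalIntegral.integral_add_adjacent_intervals
    (hwc.intervalIntegrable (μ := volume) s (s + Real.pi))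
    (hwc.intervalIntegrable (s + Real.pi) (s + Real.pi + Real.pi))
  have e3 : s + Real.pi + Real.pi = s + 2 * Real.pi := by ring
  have e4 : -Real.pi + 2 * Real.pi = Real.pi := by ring
  have p1 : Function.Periodic (fun x => (g x - g s) ^ 2) (2 * Real.pi) := fun x => by
    simp only [hp x]
  have p2 : Function.Periodic (fun x => g' x ^ 2) (2 * Real.pi) := fun x => by
    simp only [hp' x]
  rw [e3, p1.intervalIntegral_add_eq s (-Real.pi), e4] at a1
  rw [e3, p2.intervalIntegral_add_eq s (-Real.pi), e4] at a2
  have hmain : ∫ x in -Real.pi..Real.pi, (g x - g s) ^ 2 ≤ ∫ x in -Real.pi..Real.pi, g' x ^ 2 := by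
    rw [e3] at h2
    linarith
  refine le_trans ?_ hmain
  have i6 : IntervalIntegrable (fun x => g x ^ 2) volume (-Real.pi) Real.pi :=
    (hgc.pow 2).intervalIntegrable _ _
  have i7 : IntervalIntegrable (fun x => 2 * g s * g x) volume (-Real.pi) Real.pi :=
    (continuous_const.mul hgc).intervalIntegrable _ _
  rw [show (fun x => (g x - g s) ^ 2) = fun x => (g x ^ 2 - 2 * g s * g x) + g s ^ 2 from
      funext fun x => by ring, intervalIntegral.integral_add (i6.sub i7) (by simp),
      intervalIntegral.integral_sub i6 i7, intervalIntegral.integral_const_mul,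
      intervalIntegral.integral_const]
  set I := ∫ x in -Real.pi..Real.pi, g x
  have : 0 ≤ (I - 2 * Real.pi * g s) ^ 2 / (2 * Real.pi) := by positivity
  have e : (I - 2 * Real.pi * g s) ^ 2 / (2 * Real.pi)
      = I ^ 2 / (2 * Real.pi) - 2 * g s * I + (Real.pi - -Real.pi) • g s ^ 2 := by
    rw [smul_eq_mul]
    field_simp
    ring
  linarith

lemma hasDerivAt_integral_of_continuousOn {T a b x₀ : ℝ} (hab : a ≤ b) {G G' : ℝ → ℝ → ℝ}
    (hx : x₀ < T)
    (hG : ∀ x < T, Continuous (G x))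
    (hd : ∀ x < T, ∀ t, HasDerivAt (fun x => G x t) (G' x t) x)
    (hG' : ContinuousOn (fun q : ℝ × ℝ => G' q.1 q.2) (Iio T ×ˢ univ)) :
    HasDerivAt (fun x => ∫ t in a..b, G x t) (∫ t in a..b, G' x₀ t) x₀ := by
  obtain ⟨r, hr0, hr⟩ : ∃ r > 0, closedBall x₀ r ⊆ Iio T :=
    nhds_basis_closedBall.mem_iff.1 (Iio_mem_nhds hx)
  have hK : IsCompact (closedBall x₀ r ×ˢ Icc a b) :=
    (isCompact_closedBall _ _).prod isCompact_Icc
  obtain ⟨C, hC⟩ := hK.exists_bound_of_continuousOn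
    (hG'.mono (prod_mono hr (subset_univ _)))
  have hGx : Continuous (G' x₀) := by
    rw [← continuousOn_univ]
    exact hG'.comp (f := fun t : ℝ => (x₀, t)) (by fun_prop) (fun t _ => ⟨hx, trivial⟩)
  refine (intervalIntegral.hasDerivAt_integral_of_dominated_loc_of_deriv_le
    (s := closedBall x₀ r) (bound := fun _ => C) (closedBall_mem_nhds _ hr0) ?_
    ((hG _ hx).intervalIntegrable _ _) hGx.aestronglyMeasurable ?_ (by simp) ?_).2
  · filter_upwards [Iio_mem_nhds hx] with x hx using (hG x hx).aestronglyMeasurable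
  · refine Eventually.of_forall fun t ht x hxs => hC (x, t) ⟨hxs, ?_⟩
    rw [uIoc_of_le hab] at ht
    exact Ioc_subset_Icc_self ht
  · exact Eventually.of_forall fun t _ x hxs => hd x (hr hxs) t

lemma setLIntegral_complex_prod {u : ℂ → ℝ≥0∞} (hu : Measurable u) (s t : Set ℝ) :
    ∫⁻ z in s ×ℂ t, u z = ∫⁻ x in s, ∫⁻ y in t, u (x + y * Complex.I) := by
  have h1 := Complex.volume_preserving_equiv_real_prod.symm.setLIntegral_comp_preimage_emb
    (Complex.measurableEquivRealProd.symm.measurableEmbedding) u (s ×ℂ t)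
  rw [← h1]
  have h2 : (Complex.measurableEquivRealProd.symm ⁻¹' (s ×ℂ t)) = s ×ˢ t := by
    ext q; simp [Complex.mem_reProdIm]
  rw [h2, Measure.volume_eq_prod, ← Measure.prod_restrict, lintegral_prod _ (by fun_prop)]
  refine lintegral_congr fun x => lintegral_congr fun y => ?_
  congr 1
  apply Complex.ext <;> simp

lemma sq_add_sq_le_nnnorm_sq (l : ℂ →L[ℝ] ℝ) :
    l 1 ^ 2 + l Complex.I ^ 2 ≤ ‖l‖ ^ 2 := by
  set v : ℂ := (l 1 : ℂ) + (l Complex.I : ℂ) * Complex.I with hv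
  have h1 : l v = l 1 ^ 2 + l Complex.I ^ 2 := by
    have : v = (l 1) • (1 : ℂ) + (l Complex.I) • Complex.I := by simp [hv]
    rw [this, map_add, map_smul, map_smul]; simp; ring
  have h2 : ‖v‖ ^ 2 = l 1 ^ 2 + l Complex.I ^ 2 := by
    rw [← Complex.normSq_eq_norm_sq, Complex.normSq_apply]; simp [hv]; ring
  have h3 := l.le_opNorm v
  rw [h1, Real.norm_eq_abs, abs_of_nonneg (by positivity), ← h2] at h3
  rcases eq_or_lt_of_le (norm_nonneg v) with h | h
  · rw [← h2, ← h, zero_pow two_ne_zero]; exact sq_nonneg _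
  · rw [← h2]
    have : ‖v‖ ≤ ‖l‖ := by nlinarith
    gcongr

lemma ofReal_le_nnnorm_sq (l : ℂ →L[ℝ] ℝ) :
    ENNReal.ofReal (l 1 ^ 2 + l Complex.I ^ 2) ≤ (‖l‖₊ : ℝ≥0∞) ^ 2 := by
  refine (ENNReal.ofReal_le_ofReal (sq_add_sq_le_nnnorm_sq l)).trans ?_
  rw [ENNReal.ofReal_pow (norm_nonneg _), ofReal_norm]
  rfl

lemma variance_le {g : ℝ → ℝ} {a b : ℝ} (hab : a < b) (hg : Continuous g) (m : ℝ) :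
    (∫ x in a..b, g x ^ 2) - (∫ x in a..b, g x) ^ 2 / (b - a) ≤ ∫ x in a..b, (g x - m) ^ 2 := by
  have hb : 0 < b - a := by linarith
  have i6 : IntervalIntegrable (fun x => g x ^ 2) volume a b :=
    (hg.pow 2).intervalIntegrable _ _
  have i7 : IntervalIntegrable (fun x => 2 * m * g x) volume a b :=
    (continuous_const.mul hg).intervalIntegrable _ _
  rw [show (fun x => (g x - m) ^ 2) = fun x => (g x ^ 2 - 2 * m * g x) + m ^ 2 from
      funext fun x => by ring, intervalIntegral.integral_add (i6.sub i7) (by simp),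
      intervalIntegral.integral_sub i6 i7, intervalIntegral.integral_const_mul,
      intervalIntegral.integral_const]
  set I := ∫ x in a..b, g x
  have : 0 ≤ (I - (b - a) * m) ^ 2 / (b - a) := by positivity
  have e : (I - (b - a) * m) ^ 2 / (b - a)
      = I ^ 2 / (b - a) - 2 * m * I + (b - a) • m ^ 2 := by
    rw [smul_eq_mul]
    field_simp
    ring
  linarith

lemma strip_energy {P : ℂ → ℝ} (hP : ContDiffOn ℝ 1 P (ball 0 1)) {η c : ℝ} (hη : 0 < η)
    (hc : -Real.pi < c)
    (hW : ∀ g g' : ℝ → ℝ, (∀ x, HasDerivAt g (g' x) x) → Continuous g' →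
      Function.Periodic g (2 * Real.pi) →
      (∫ x in -Real.pi..c, g x ^ 2) - (∫ x in -Real.pi..c, g x) ^ 2 / (c - -Real.pi)
        ≤ ∫ x in -Real.pi..c, g' x ^ 2)
    (h0 : ∫ y in -Real.pi..c, P (Complex.exp ((-η : ℝ) + y * Complex.I)) = 0) :
    ∫⁻ y in Ioo (-Real.pi) c, ENNReal.ofReal (P (Complex.exp ((-η : ℝ) + y * Complex.I)) ^ 2)
      ≤ ∫⁻ z in Iio (-η) ×ℂ Ioo (-Real.pi) c,
          (‖fderiv ℝ (fun z => P (Complex.exp z)) z‖₊ : ℝ≥0∞) ^ 2 := by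
  set G : ℂ → ℝ := fun z => P (Complex.exp z) with hGdef
  set U : Set ℂ := {z | z.re < 0} with hU
  have hUo : IsOpen U := isOpen_lt Complex.continuous_re continuous_const
  have hexp : ∀ z ∈ U, Complex.exp z ∈ ball (0 : ℂ) 1 := by
    intro z hz
    rw [mem_ball_zero_iff, Complex.norm_exp]
    exact by simpa using Real.exp_lt_exp.2 hz
  have hG : ContDiffOn ℝ 1 G U :=
    hP.comp Complex.contDiff_exp.contDiffOn hexp
  have hmem : ∀ x < (0 : ℝ), ∀ y : ℝ, (x + y * Complex.I : ℂ) ∈ U := by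
    intro x hx y; simpa [hU] using hx
  have hfd : ∀ x < (0 : ℝ), ∀ y : ℝ,
      HasFDerivAt G (fderiv ℝ G (x + y * Complex.I)) (x + y * Complex.I) := fun x hx y =>
    ((hG.differentiableOn one_ne_zero).differentiableAt
      (hUo.mem_nhds (hmem x hx y))).hasFDerivAt
  have hfc : ContinuousOn (fderiv ℝ G) U := hG.continuousOn_fderiv_of_isOpen hUo le_rfl
  set G1 : ℝ → ℝ → ℝ := fun x y => fderiv ℝ G (x + y * Complex.I) 1 with hG1
  set G2 : ℝ → ℝ → ℝ := fun x y => fderiv ℝ G (x + y * Complex.I) Complex.I with hG2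
  set g : ℝ → ℝ → ℝ := fun x y => G (x + y * Complex.I) with hg
  have hmap : Continuous fun q : ℝ × ℝ => (q.1 + q.2 * Complex.I : ℂ) := by fun_prop
  have hmaps : MapsTo (fun q : ℝ × ℝ => (q.1 + q.2 * Complex.I : ℂ)) (Iio 0 ×ˢ univ) U :=
    fun q hq => hmem _ hq.1 _
  have hG1c : ContinuousOn (fun q : ℝ × ℝ => G1 q.1 q.2) (Iio 0 ×ˢ univ) :=
    (hfc.comp hmap.continuousOn hmaps).clm_apply continuousOn_const
  have hG2c : ContinuousOn (fun q : ℝ × ℝ => G2 q.1 q.2) (Iio 0 ×ˢ univ) :=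
    (hfc.comp hmap.continuousOn hmaps).clm_apply continuousOn_const
  have hgc : ContinuousOn (fun q : ℝ × ℝ => g q.1 q.2) (Iio 0 ×ˢ univ) :=
    hG.continuousOn.comp hmap.continuousOn hmaps
  have slice : ∀ {k : ℝ → ℝ → ℝ}, ContinuousOn (fun q : ℝ × ℝ => k q.1 q.2) (Iio 0 ×ˢ univ) →
      ∀ x < (0 : ℝ), Continuous (k x) := by
    intro k hk x hx
    rw [← continuousOn_univ]
    exact hk.comp (f := fun t : ℝ => (x, t)) (by fun_prop) (fun t _ => ⟨hx, trivial⟩)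
  have hd1 : ∀ x < (0 : ℝ), ∀ y, HasDerivAt (fun x => g x y) (G1 x y) x := by
    intro x hx y
    have h2 : HasDerivAt (fun x : ℝ => (x + y * Complex.I : ℂ)) 1 x :=
      (Complex.ofRealCLM.hasDerivAt (x := x)).add_const _ |>.congr_deriv (by simp)
    exact HasFDerivAt.comp_hasDerivAt (f := fun x : ℝ => (x + y * Complex.I : ℂ)) (l := G)
      x (hfd x hx y) h2
  have hd2 : ∀ x < (0 : ℝ), ∀ y, HasDerivAt (g x) (G2 x y) y := by
    intro x hx y
    have h2 : HasDerivAt (fun y : ℝ => (x + y * Complex.I : ℂ)) Complex.I y := by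
      simpa using ((Complex.ofRealCLM.hasDerivAt (x := y)).mul_const Complex.I).const_add (x : ℂ)
    exact HasFDerivAt.comp_hasDerivAt (f := fun y : ℝ => (x + y * Complex.I : ℂ)) (l := G)
      y (hfd x hx y) h2
  have hper : ∀ x, Function.Periodic (g x) (2 * Real.pi) := by
    intro x y
    simp only [hg, hGdef]
    congr 1
    rw [show ((x : ℂ) + ((y + 2 * Real.pi : ℝ) : ℂ) * Complex.I)
      = x + y * Complex.I + 2 * Real.pi * Complex.I by push_cast; ring, Complex.exp_periodic]
  have hlen : 0 < c - -Real.pi := by linarith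
  set V : ℝ → ℝ := fun x => (∫ y in -Real.pi..c, g x y ^ 2)
    - (∫ y in -Real.pi..c, g x y) ^ 2 / (c - -Real.pi) with hV
  set e : ℝ → ℝ := fun x => ∫ y in -Real.pi..c, (G1 x y ^ 2 + G2 x y ^ 2) with he
  have hVd : ∀ x < (0 : ℝ), HasDerivAt V ((∫ y in -Real.pi..c, 2 * g x y * G1 x y)
      - 2 * (∫ y in -Real.pi..c, g x y) * (∫ y in -Real.pi..c, G1 x y) / (c - -Real.pi)) x := by
    intro x hx
    have h1 := hasDerivAt_integral_of_continuousOn hc.le (G := fun x y => g x y ^ 2)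
      (G' := fun x y => 2 * g x y * G1 x y) hx
      (fun x hx => (slice hgc x hx).pow 2)
      (fun x hx t => ((hd1 x hx t).fun_pow 2).congr_deriv (by simp))
      ((continuousOn_const.mul hgc).mul hG1c)
    have h2 := hasDerivAt_integral_of_continuousOn hc.le (G := g) (G' := G1) hx
      (fun x hx => slice hgc x hx) hd1 hG1c
    exact (h1.sub ((h2.pow 2).div_const _)).congr_deriv (by simp)
  have hVle : ∀ x < (0 : ℝ), (∫ y in -Real.pi..c, 2 * g x y * G1 x y)
      - 2 * (∫ y in -Real.pi..c, g x y) * (∫ y in -Real.pi..c, G1 x y) / (c - -Real.pi) ≤ e x := by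
    intro x hx
    have c0 := slice hgc x hx
    have c1 := slice hG1c x hx
    have c2 := slice hG2c x hx
    have hw := hW _ _ (hd2 x hx) c2 (hper x)
    set I := ∫ y in -Real.pi..c, g x y with hI
    set M := I / (c - -Real.pi) with hM
    have hpos : 0 ≤ ∫ y in -Real.pi..c, (G1 x y - (g x y - M)) ^ 2 :=
      intervalIntegral.integral_nonneg hc.le fun x _ => sq_nonneg _
    have j1 : IntervalIntegrable (fun y => G1 x y ^ 2) volume (-Real.pi) c :=
      (c1.pow 2).intervalIntegrable _ _
    have j2 : IntervalIntegrable (fun y => G2 x y ^ 2) volume (-Real.pi) c :=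
      (c2.pow 2).intervalIntegrable _ _
    have j3 : IntervalIntegrable (fun y => 2 * g x y * G1 x y) volume (-Real.pi) c :=
      ((continuous_const.mul c0).mul c1).intervalIntegrable _ _
    have j4 : IntervalIntegrable (fun y => 2 * M * G1 x y) volume (-Real.pi) c :=
      (continuous_const.mul c1).intervalIntegrable _ _
    have j5 : IntervalIntegrable (fun y => g x y ^ 2) volume (-Real.pi) c :=
      (c0.pow 2).intervalIntegrable _ _
    have j6 : IntervalIntegrable (fun y => 2 * M * g x y) volume (-Real.pi) c :=
      (continuous_const.mul c0).intervalIntegrable _ _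
    rw [show (fun y => (G1 x y - (g x y - M)) ^ 2) = fun y => (G1 x y ^ 2 - 2 * g x y * G1 x y)
        + 2 * M * G1 x y + (g x y ^ 2 - 2 * M * g x y) + M ^ 2 from funext fun y => by ring,
      intervalIntegral.integral_add (((j1.sub j3).add j4).add (j5.sub j6)) (by simp),
      intervalIntegral.integral_add ((j1.sub j3).add j4) (j5.sub j6),
      intervalIntegral.integral_add (j1.sub j3) j4,
      intervalIntegral.integral_sub j1 j3, intervalIntegral.integral_sub j5 j6,
      intervalIntegral.integral_const_mul, intervalIntegral.integral_const_mul, ← hI,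
      intervalIntegral.integral_const, smul_eq_mul] at hpos
    simp only [he]
    rw [intervalIntegral.integral_add j1 j2]
    have hMI : I = M * (c - -Real.pi) := by rw [hM]; field_simp
    have e1 : I ^ 2 / (c - -Real.pi) = M * I := by rw [hM]; ring
    have e2 : 2 * I * (∫ y in -Real.pi..c, G1 x y) / (c - -Real.pi)
      = 2 * M * ∫ y in -Real.pi..c, G1 x y := by rw [hM]; ring
    rw [e1] at hw
    rw [e2]
    have e3 : (c - -Real.pi) * M ^ 2 = M * I := by rw [hMI]; ring
    linarith
  have hint : ∀ x0 : ℝ, IntegrableOn e (Icc x0 (-η)) := by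
    intro x0
    have hcomp : IsCompact (Icc x0 (-η) ×ˢ Icc (-Real.pi) c) := isCompact_Icc.prod isCompact_Icc
    have hci : ContinuousOn (fun q : ℝ × ℝ => G1 q.1 q.2 ^ 2 + G2 q.1 q.2 ^ 2)
        (Icc x0 (-η) ×ˢ Icc (-Real.pi) c) :=
      ((hG1c.pow 2).add (hG2c.pow 2)).mono fun q hq =>
        ⟨lt_of_le_of_lt hq.1.2 (by linarith), trivial⟩
    have h1 : IntegrableOn (fun q : ℝ × ℝ => G1 q.1 q.2 ^ 2 + G2 q.1 q.2 ^ 2)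
        (Icc x0 (-η) ×ˢ Ioc (-Real.pi) c) :=
      (hci.integrableOn_compact hcomp).mono_set (prod_mono_right Ioc_subset_Icc_self)
    rw [IntegrableOn, Measure.volume_eq_prod, ← Measure.prod_restrict] at h1
    have h2 := h1.integral_prod_left
    simp only [he, intervalIntegral.integral_of_le hc.le]
    exact h2
  set E := ∫⁻ z in Iio (-η) ×ℂ Ioo (-Real.pi) c, (‖fderiv ℝ G z‖₊ : ℝ≥0∞) ^ 2 with hE
  have hEe : ∀ x0 ≤ -η, ENNReal.ofReal (∫ x in x0..-η, e x) ≤ E := by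
    intro x0 hx0
    have he0 : ∀ x, 0 ≤ e x := fun x =>
      intervalIntegral.integral_nonneg hc.le fun y _ => by positivity
    rw [intervalIntegral.integral_of_le hx0, integral_Ioc_eq_integral_Ioo,
      ofReal_integral_eq_lintegral_ofReal ((hint x0).mono_set Ioo_subset_Icc_self)
        (Eventually.of_forall he0), hE, setLIntegral_complex_prod (by
          have := measurable_fderiv ℝ G
          fun_prop)]
    refine (lintegral_mono_ae ?_).trans (lintegral_mono_set Ioo_subset_Iio_self)
    filter_upwards [self_mem_ae_restrict measurableSet_Ioo] with x hx
    have hx0 : x < 0 := hx.2.trans (by linarith)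
    have cc : Continuous fun y => G1 x y ^ 2 + G2 x y ^ 2 :=
      ((slice hG1c x hx0).pow 2).add ((slice hG2c x hx0).pow 2)
    simp only [he]
    rw [intervalIntegral.integral_of_le hc.le, integral_Ioc_eq_integral_Ioo,
      ofReal_integral_eq_lintegral_ofReal
        ((cc.integrableOn_Icc).mono_set Ioo_subset_Icc_self)
        (Eventually.of_forall fun y => by positivity)]
    exact lintegral_mono fun y => ofReal_le_nnnorm_sq _
  have hη0 : -η < 0 := by linarith
  have hfin : ∀ κ : ℝ, 0 < κ → ENNReal.ofReal (V (-η)) ≤ E + ENNReal.ofReal (κ ^ 2 * (c - -Real.pi)) := by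
    intro κ hκ
    have hP0 : ContinuousAt P 0 := hP.continuousOn.continuousAt (ball_mem_nhds _ one_pos)
    obtain ⟨r, hr, hPr⟩ := Metric.continuousAt_iff.1 hP0 κ hκ
    obtain ⟨x0, hx0, hx0η⟩ : ∃ x0 : ℝ, Real.exp x0 < r ∧ x0 ≤ -η := by
      have h1 := (Real.tendsto_exp_atBot.eventually (gt_mem_nhds hr)).and
        (eventually_le_atBot (-η))
      exact h1.exists
    have h1 := intervalIntegral.sub_le_integral_of_hasDeriv_right_of_le hx0η
      (fun x hx => (hVd x (lt_of_le_of_lt hx.2 hη0)).continuousAt.continuousWithinAt)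
      (fun x hx => (hVd x (hx.2.trans hη0)).hasDerivWithinAt) (hint x0)
      (fun x hx => hVle x (hx.2.trans hη0))
    have h2 : V x0 ≤ κ ^ 2 * (c - -Real.pi) := by
      refine (variance_le hc (slice hgc x0 (by linarith)) (P 0)).trans ?_
      have h3 : ∀ y ∈ Icc (-Real.pi) c, (g x0 y - P 0) ^ 2 ≤ κ ^ 2 := by
        intro y _
        have h4 : dist (Complex.exp (x0 + y * Complex.I)) 0 < r := by
          rw [dist_zero_right, Complex.norm_exp]; simpa using hx0
        have h5 := hPr h4
        rw [Real.dist_eq] at h5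
        exact sq_le_sq' (by linarith [(abs_lt.1 h5).1]) (abs_lt.1 h5).2.le
      refine (intervalIntegral.integral_mono_on hc.le
        ((((slice hgc x0 (by linarith)).sub continuous_const).pow 2).intervalIntegrable _ _)
        (by simp) h3).trans ?_
      simp [mul_comm]
    refine (ENNReal.ofReal_le_ofReal (show V (-η) ≤ (∫ x in x0..-η, e x)
      + κ ^ 2 * (c - -Real.pi) by linarith)).trans ?_
    exact ENNReal.ofReal_add_le.trans (add_le_add_left (hEe x0 hx0η) _)
  have hVE : ENNReal.ofReal (V (-η)) ≤ E := by
    have ht : Tendsto (fun κ : ℝ => E + ENNReal.ofReal (κ ^ 2 * (c - -Real.pi))) (𝓝[>] 0)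
        (𝓝 (E + ENNReal.ofReal (0 ^ 2 * (c - -Real.pi)))) := by
      refine Tendsto.const_add _ ((ENNReal.continuous_ofReal.comp ?_).tendsto 0
        |>.mono_left nhdsWithin_le_nhds)
      fun_prop
    simp only [ne_eq, OfNat.ofNat_ne_zero, not_false_eq_true, zero_pow, zero_mul,
      ENNReal.ofReal_zero, add_zero] at ht
    exact ge_of_tendsto ht (by filter_upwards [self_mem_nhdsWithin] with κ hκ using hfin κ hκ)
  refine le_trans (le_of_eq ?_) hVE
  have cη : Continuous fun y => g (-η) y ^ 2 := (slice hgc (-η) hη0).pow 2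
  have hVη : V (-η) = ∫ y in -Real.pi..c, g (-η) y ^ 2 := by
    simp only [hV]
    rw [show ∫ y in -Real.pi..c, g (-η) y = 0 from h0]
    simp
  rw [hVη, intervalIntegral.integral_of_le hc.le, integral_Ioc_eq_integral_Ioo,
    ofReal_integral_eq_lintegral_ofReal
      ((cη.integrableOn_Icc).mono_set Ioo_subset_Icc_self)
      (Eventually.of_forall fun y => by positivity)]

lemma det_smul_one_complex (c : ℂ) : (c • (1 : ℂ →L[ℝ] ℂ)).det = ‖c‖ ^ 2 := by
  have h : ((c • (1 : ℂ →L[ℝ] ℂ) : ℂ →L[ℝ] ℂ) : ℂ →ₗ[ℝ] ℂ) = Algebra.lmul ℝ ℂ c := by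
    ext; simp
  rw [ContinuousLinearMap.det, h, ← Algebra.norm_apply, Algebra.norm_complex_apply,
    Complex.normSq_eq_norm_sq]

lemma conformal_energy_le {Ψ Ψ' : ℂ → ℂ} {S : Set ℂ} (hS : MeasurableSet S)
    (hΨ : ∀ z ∈ S, HasDerivAt Ψ (Ψ' z) z) (hinj : InjOn Ψ S) {F : ℂ → ℝ}
    (hF : ∀ z ∈ S, DifferentiableAt ℝ F (Ψ z)) :
    ∫⁻ z in S, (‖fderiv ℝ (fun z => F (Ψ z)) z‖₊ : ℝ≥0∞) ^ 2
      ≤ ∫⁻ w in Ψ '' S, (‖fderiv ℝ F w‖₊ : ℝ≥0∞) ^ 2 := by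
  have hd : ∀ z ∈ S, HasFDerivAt Ψ (Ψ' z • (1 : ℂ →L[ℝ] ℂ)) z := fun z hz =>
    (hΨ z hz).complexToReal_fderiv
  rw [lintegral_image_eq_lintegral_abs_det_fderiv_mul volume hS
    (fun z hz => (hd z hz).hasFDerivWithinAt) hinj]
  refine setLIntegral_mono' hS fun z hz => ?_
  have hc : HasFDerivAt (fun z => F (Ψ z)) ((fderiv ℝ F (Ψ z)).comp (Ψ' z • (1 : ℂ →L[ℝ] ℂ))) z :=
    HasFDerivAt.comp z (hF z hz).hasFDerivAt (hd z hz)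
  rw [hc.fderiv, det_smul_one_complex, abs_of_nonneg (by positivity)]
  have h1 : ‖(fderiv ℝ F (Ψ z)).comp (Ψ' z • (1 : ℂ →L[ℝ] ℂ))‖₊
      ≤ ‖fderiv ℝ F (Ψ z)‖₊ * ‖Ψ' z‖₊ := by
    refine (ContinuousLinearMap.opNNNorm_comp_le _ _).trans ?_
    gcongr
    rw [← NNReal.coe_le_coe]
    refine ContinuousLinearMap.opNorm_le_bound _ (norm_nonneg _) fun x => ?_
    simp
  have h2 : ENNReal.ofReal (‖Ψ' z‖ ^ 2) = (‖Ψ' z‖₊ : ℝ≥0∞) ^ 2 := by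
    rw [ENNReal.ofReal_pow (norm_nonneg _), ofReal_norm]; rfl
  rw [h2, ← mul_pow, mul_comm (‖Ψ' z‖₊ : ℝ≥0∞)]
  gcongr
  exact_mod_cast h1

lemma ofReal_sub_sq_le {g g' : ℝ → ℝ} {a b : ℝ} (hab : a ≤ b)
    (hg : ∀ x ∈ Icc a b, HasDerivAt g (g' x) x) (hg' : ContinuousOn g' (Icc a b)) :
    ENNReal.ofReal ((g b - g a) ^ 2)
      ≤ ENNReal.ofReal (b - a) * ∫⁻ x in Ioo a b, ENNReal.ofReal (g' x ^ 2) := by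
  have hu : uIcc a b = Icc a b := uIcc_of_le hab
  have i1 : IntervalIntegrable g' volume a b := (hu ▸ hg').intervalIntegrable
  have i2 : IntervalIntegrable (fun x => g' x ^ 2) volume a b :=
    ((hu ▸ hg').pow 2).intervalIntegrable
  have hftc : ∫ x in a..b, g' x = g b - g a :=
    intervalIntegral.integral_eq_sub_of_hasDerivAt (hu ▸ hg) i1
  have key : (g b - g a) ^ 2 ≤ (b - a) * ∫ x in a..b, g' x ^ 2 := by
    rcases hab.eq_or_lt with rfl | hlt
    · simp
    have hpos : ∀ m : ℝ, 0 ≤ ∫ x in a..b, (g' x - m) ^ 2 := fun m =>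
      intervalIntegral.integral_nonneg hab fun x _ => sq_nonneg _
    have h := hpos ((g b - g a) / (b - a))
    rw [show (fun x => (g' x - (g b - g a) / (b - a)) ^ 2)
        = fun x => (g' x ^ 2 - 2 * ((g b - g a) / (b - a)) * g' x)
          + ((g b - g a) / (b - a)) ^ 2 from funext fun x => by ring,
      intervalIntegral.integral_add (i2.sub (i1.const_mul _)) (by simp),
      intervalIntegral.integral_sub i2 (i1.const_mul _), intervalIntegral.integral_const_mul,
      intervalIntegral.integral_const, hftc, smul_eq_mul] at h
    have hb : 0 < b - a := by linarith
    have e : (∫ x in a..b, g' x ^ 2) - 2 * ((g b - g a) / (b - a)) * (g b - g a)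
        + (b - a) * ((g b - g a) / (b - a)) ^ 2
        = (∫ x in a..b, g' x ^ 2) - (g b - g a) ^ 2 / (b - a) := by
      field_simp; ring
    rw [e, sub_nonneg, div_le_iff₀ hb] at h
    linarith
  refine (ENNReal.ofReal_le_ofReal key).trans (le_of_eq ?_)
  rw [ENNReal.ofReal_mul (by linarith), intervalIntegral.integral_of_le hab,
    integral_Ioc_eq_integral_Ioo, ofReal_integral_eq_lintegral_ofReal
      ((intervalIntegrable_iff_integrableOn_Ioo_of_le hab).1 i2)
      (Eventually.of_forall fun y => by positivity)]

/-- Difference of a function along horizontal segments is controlled by its energy. -/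
lemma horizontal_diff_le {u : ℂ → ℝ} {U : Set ℂ} (hU : IsOpen U) (hu : ContDiffOn ℝ 1 u U)
    {a b y : ℝ} (hab : a ≤ b) (hseg : ∀ x ∈ Icc a b, (x + y * Complex.I : ℂ) ∈ U) :
    ENNReal.ofReal ((u (b + y * Complex.I) - u (a + y * Complex.I)) ^ 2)
      ≤ ENNReal.ofReal (b - a) * ∫⁻ x in Ioo a b,
        (‖fderiv ℝ u (x + y * Complex.I)‖₊ : ℝ≥0∞) ^ 2 := by
  have hfc : ContinuousOn (fderiv ℝ u) U := hu.continuousOn_fderiv_of_isOpen hU le_rfl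
  have hmap : Continuous fun x : ℝ => (x + y * Complex.I : ℂ) := by fun_prop
  refine (ofReal_sub_sq_le (g := fun x : ℝ => u (x + y * Complex.I))
    (g' := fun x => fderiv ℝ u (x + y * Complex.I) 1) hab (fun x hx => ?_)
    ((hfc.comp hmap.continuousOn hseg).clm_apply continuousOn_const)).trans ?_
  · have h2 : HasDerivAt (fun x : ℝ => (x + y * Complex.I : ℂ)) 1 x :=
      (Complex.ofRealCLM.hasDerivAt (x := x)).add_const _ |>.congr_deriv (by simp)
    exact HasFDerivAt.comp_hasDerivAt (f := fun x : ℝ => (x + y * Complex.I : ℂ)) (l := u) x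
      ((hu.differentiableOn one_ne_zero).differentiableAt
        (hU.mem_nhds (hseg x hx))).hasFDerivAt h2
  · gcongr with x
    refine le_trans (ENNReal.ofReal_le_ofReal ?_) (ofReal_le_nnnorm_sq _)
    nlinarith [sq_nonneg (fderiv ℝ u (x + y * Complex.I) Complex.I)]

lemma lintegral_complex_symm {u : ℂ → ℝ≥0∞} (hu : Measurable u) :
    ∫⁻ z, u z = ∫⁻ y : ℝ, ∫⁻ x : ℝ, u (x + y * Complex.I) := by
  have h1 := Complex.volume_preserving_equiv_real_prod.symm.lintegral_comp hu
  rw [← h1, Measure.volume_eq_prod, lintegral_prod_symm _ (by fun_prop)]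
  refine lintegral_congr fun x => lintegral_congr fun y => ?_
  congr 1
  apply Complex.ext <;> simp

/-- The open strip `|Im z| < π`. -/
def piStrip : Set ℂ := {z | -Real.pi < z.im ∧ z.im < Real.pi}

lemma isOpen_piStrip : IsOpen piStrip :=
  (isOpen_lt continuous_const Complex.continuous_im).inter
    (isOpen_lt Complex.continuous_im continuous_const)

lemma exp_add_one_ne_zero {z : ℂ} (hz : z ∈ piStrip) : Complex.exp z + 1 ≠ 0 := by
  intro h
  have h1 : Complex.exp z = -1 := eq_neg_of_add_eq_zero_left h
  have h2 := Complex.log_exp hz.1 hz.2.le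
  rw [h1, Complex.log_neg_one] at h2
  have := hz.2
  rw [← h2] at this
  simp at this

/-- The conformal map `ζ ↦ ε tanh (ζ / 2)` from a half strip to a half plane. -/
def mob (ε : ℝ) (z : ℂ) : ℂ := ε * ((Complex.exp z - 1) / (Complex.exp z + 1))

lemma hasDerivAt_mob (ε : ℝ) {z : ℂ} (hz : z ∈ piStrip) :
    HasDerivAt (mob ε) (ε * ((Complex.exp z * (Complex.exp z + 1)
      - (Complex.exp z - 1) * Complex.exp z) / (Complex.exp z + 1) ^ 2)) z :=
  ((((Complex.hasDerivAt_exp z).sub_const 1).div ((Complex.hasDerivAt_exp z).add_const 1)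
    (exp_add_one_ne_zero hz)).const_mul _)

lemma contDiffOn_mob (ε : ℝ) : ContDiffOn ℝ 1 (mob ε) piStrip :=
  (DifferentiableOn.contDiffOn (n := 1) (fun _ hz =>
    (hasDerivAt_mob ε hz).differentiableAt.differentiableWithinAt) isOpen_piStrip).restrict_scalars ℝ

lemma injOn_mob {ε : ℝ} (hε : 0 < ε) : InjOn (mob ε) piStrip := by
  intro z hz w hw h
  have h1 := exp_add_one_ne_zero hz
  have h2 := exp_add_one_ne_zero hw
  have hε' : (ε : ℂ) ≠ 0 := by exact_mod_cast hε.ne'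
  have h3 := mul_left_cancel₀ hε' h
  rw [div_eq_div_iff h1 h2] at h3
  have h4 : Complex.exp z = Complex.exp w := by linear_combination h3 / 2
  have := congrArg Complex.log h4
  rwa [Complex.log_exp hz.1 hz.2.le, Complex.log_exp hw.1 hw.2.le] at this

lemma mobius_re (w : ℂ) :
    ((w - 1) / (w + 1)).re = (‖w‖ ^ 2 - 1) / Complex.normSq (w + 1) := by
  rw [Complex.div_re, ← add_div, ← Complex.normSq_eq_norm_sq, Complex.normSq_apply w]
  congr 1
  simp; ring

lemma mobius_im (w : ℂ) : ((w - 1) / (w + 1)).im = 2 * w.im / Complex.normSq (w + 1) := by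
  rw [Complex.div_im, ← sub_div]
  congr 1
  simp; ring

lemma mob_re_neg {ε : ℝ} (hε : 0 < ε) {z : ℂ} (hz : z ∈ piStrip) (hre : z.re < 0) :
    (mob ε z).re < 0 := by
  rw [mob, Complex.re_ofReal_mul, mobius_re]
  have h1 : 0 < Complex.normSq (Complex.exp z + 1) :=
    Complex.normSq_pos.2 (exp_add_one_ne_zero hz)
  have h2 : ‖Complex.exp z‖ ^ 2 - 1 < 0 := by
    rw [Complex.norm_exp]
    have : Real.exp z.re < 1 := by simpa using hre
    nlinarith [Real.exp_pos z.re]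
  exact mul_neg_of_pos_of_neg hε (div_neg_of_neg_of_pos h2 h1)

lemma mob_im_neg {ε : ℝ} (hε : 0 < ε) {z : ℂ} (hz : z ∈ piStrip) (him : z.im < 0) :
    (mob ε z).im < 0 := by
  rw [mob, Complex.im_ofReal_mul, mobius_im]
  have h1 : 0 < Complex.normSq (Complex.exp z + 1) :=
    Complex.normSq_pos.2 (exp_add_one_ne_zero hz)
  have h2 : (Complex.exp z).im < 0 := by
    rw [Complex.exp_im]
    exact mul_neg_of_pos_of_neg (Real.exp_pos _) (Real.sin_neg_of_neg_of_neg_pi_lt him hz.1)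
  exact mul_neg_of_pos_of_neg hε (div_neg_of_neg_of_pos (by linarith) h1)

lemma abs_mob_im_lt_of_re_lt {ε η : ℝ} (hε : 0 < ε) (hη : 0 < η) {z : ℂ} (hre : z.re < -η) :
    |(mob ε z).im| < ε * 2 / (1 - Real.exp (-η)) := by
  have h1 : Real.exp (-η) < 1 := by simpa using hη
  have h2 : ‖Complex.exp z‖ < Real.exp (-η) := by
    rw [Complex.norm_exp]; exact Real.exp_lt_exp.2 hre
  have h3 : 1 - Real.exp (-η) < ‖Complex.exp z + 1‖ := by
    have := norm_sub_norm_le (1 : ℂ) (-Complex.exp z)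
    rw [norm_neg, norm_one, sub_neg_eq_add, add_comm (1 : ℂ)] at this
    linarith
  have h4 : ‖Complex.exp z - 1‖ < 2 := by
    have := norm_sub_le (Complex.exp z) 1
    rw [norm_one] at this
    linarith
  refine (Complex.abs_im_le_norm _).trans_lt ?_
  rw [mob, norm_mul, Complex.norm_real, Real.norm_of_nonneg hε.le, norm_div, mul_div_assoc]
  gcongr

lemma abs_tan_half {β : ℝ} (h1 : -Real.pi < β) (h2 : β < Real.pi) :
    Real.sin β / (1 + Real.cos β) = Real.tan (β / 2) := by
  have hc : 0 < Real.cos (β / 2) := Real.cos_pos_of_mem_Ioo ⟨by linarith, by linarith⟩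
  rw [Real.tan_eq_sin_div_cos, show Real.sin β = 2 * Real.sin (β / 2) * Real.cos (β / 2) by
      rw [← Real.sin_two_mul]; congr 1; ring, show 1 + Real.cos β = 2 * Real.cos (β / 2) ^ 2 by
      rw [Real.cos_sq]; ring_nf]
  field_simp

lemma abs_mob_im_le {ε : ℝ} (hε : 0 < ε) {z : ℂ} (hz : z ∈ piStrip) :
    |(mob ε z).im| ≤ ε * |Real.tan (z.im / 2)| := by
  rw [mob, Complex.im_ofReal_mul, mobius_im, abs_mul, abs_of_pos hε, ← abs_tan_half hz.1 hz.2]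
  refine mul_le_mul_of_nonneg_left ?_ hε.le
  have hc : 0 < 1 + Real.cos z.im := by
    have hc : 0 < Real.cos (z.im / 2) :=
      Real.cos_pos_of_mem_Ioo ⟨by linarith [hz.1], by linarith [hz.2]⟩
    rw [show 1 + Real.cos z.im = 2 * Real.cos (z.im / 2) ^ 2 by rw [Real.cos_sq]; ring_nf]
    positivity
  have h1 : 0 < Complex.normSq (Complex.exp z + 1) :=
    Complex.normSq_pos.2 (exp_add_one_ne_zero hz)
  rw [abs_div, abs_div, abs_of_pos hc, abs_of_pos h1, div_le_div_iff₀ h1 hc,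
    Complex.normSq_apply, Complex.exp_im, abs_mul, abs_mul, abs_of_pos (Real.exp_pos _)]
  simp only [Complex.add_re, Complex.one_re, Complex.add_im, Complex.one_im, Complex.exp_re,
    Complex.exp_im, add_zero, Nat.abs_ofNat]
  have hs := Real.sin_sq_add_cos_sq z.im
  set r := Real.exp z.re
  have e : (r * Real.cos z.im + 1) * (r * Real.cos z.im + 1)
      + r * Real.sin z.im * (r * Real.sin z.im)
      = (r - 1) ^ 2 + 2 * r * (1 + Real.cos z.im) := by linear_combination r ^ 2 * hs
  rw [e]
  nlinarith [mul_nonneg (abs_nonneg (Real.sin z.im)) (sq_nonneg (r - 1))]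

lemma mob_two_arctan {ε : ℝ} (hε : 0 < ε) (y : ℝ) :
    mob ε ((2 * Real.arctan (y / ε) : ℝ) * Complex.I) = y * Complex.I := by
  set a := Real.arctan (y / ε) with ha
  have hz : (((2 * a : ℝ) : ℂ) * Complex.I) ∈ piStrip := by
    have h1 := Real.neg_pi_div_two_lt_arctan (y / ε)
    have h2 := Real.arctan_lt_pi_div_two (y / ε)
    refine ⟨?_, ?_⟩ <;> simp <;> linarith
  have hc : 0 < Real.cos a := Real.cos_arctan_pos _
  have ht : Real.tan a = y / ε := Real.tan_arctan _
  have hN : Complex.normSq (Complex.exp ((2 * a : ℝ) * Complex.I) + 1)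
      = 2 * (1 + Real.cos (2 * a)) := by
    rw [Complex.normSq_apply]
    simp only [Complex.add_re, Complex.one_re, Complex.add_im, Complex.one_im,
      Complex.exp_ofReal_mul_I_re, Complex.exp_ofReal_mul_I_im, add_zero]
    linear_combination Real.sin_sq_add_cos_sq (2 * a)
  apply Complex.ext
  · rw [mob, Complex.re_ofReal_mul, mobius_re, Complex.norm_exp_ofReal_mul_I]
    simp
  · rw [mob, Complex.im_ofReal_mul, mobius_im, hN, Complex.exp_ofReal_mul_I_im,
      mul_div_mul_left _ _ two_ne_zero, abs_tan_half]
    · rw [mul_div_cancel_left₀ _ two_ne_zero, ht]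
      simp; field_simp
    · simpa using hz.1
    · simpa using hz.2

lemma setLIntegral_complex_between {u : ℂ → ℝ≥0∞} (hu : Measurable u) {I : Set ℝ}
    (hI : MeasurableSet I) {f g : ℝ → ℝ} (hf : Measurable f) (hg : Measurable g) :
    ∫⁻ z in {z : ℂ | z.im ∈ I ∧ f z.im < z.re ∧ z.re < g z.im}, u z
      = ∫⁻ y in I, ∫⁻ x in Ioo (f y) (g y), u (x + y * Complex.I) := by
  have hS : MeasurableSet {z : ℂ | z.im ∈ I ∧ f z.im < z.re ∧ z.re < g z.im} :=
    (Complex.measurable_im hI).inter ((measurableSet_lt (hf.comp Complex.measurable_im)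
      Complex.measurable_re).inter (measurableSet_lt Complex.measurable_re
        (hg.comp Complex.measurable_im)))
  rw [← lintegral_indicator hS, lintegral_complex_symm (hu.indicator hS),
    ← lintegral_indicator hI]
  refine lintegral_congr fun y => ?_
  by_cases hy : y ∈ I
  · rw [indicator_of_mem hy, ← lintegral_indicator measurableSet_Ioo]
    refine lintegral_congr fun x => ?_
    by_cases hx : x ∈ Ioo (f y) (g y)
    · rw [indicator_of_mem hx, indicator_of_mem]
      simpa using ⟨hy, hx.1, hx.2⟩
    · rw [indicator_of_notMem hx, indicator_of_notMem]
      simpa [hy] using hx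
  · rw [indicator_of_notMem hy, lintegral_eq_zero_iff']
    · exact Eventually.of_forall fun x => indicator_of_notMem (by simp [hy]) _
    · exact ((hu.indicator hS).comp (by fun_prop)).aemeasurable

lemma setLIntegral_two_arctan_le {ε x1 x2 : ℝ} (hε : 0 < ε) (g : ℝ → ℝ≥0∞) :
    ∫⁻ y in Ioo x1 x2, ENNReal.ofReal (2 * ε / (ε ^ 2 + y ^ 2)) * g (2 * Real.arctan (y / ε))
      ≤ ∫⁻ β in Ioo (2 * Real.arctan (x1 / ε)) (2 * Real.arctan (x2 / ε)), g β := by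
  have hd : ∀ y : ℝ, HasDerivAt (fun y => 2 * Real.arctan (y / ε)) (2 * ε / (ε ^ 2 + y ^ 2)) y := by
    intro y
    refine ((((hasDerivAt_id y).div_const ε).arctan).const_mul 2).congr_deriv ?_
    simp only [id]
    field_simp
  have hmono : StrictMono fun y => 2 * Real.arctan (y / ε) := fun a b hab =>
    mul_lt_mul_of_pos_left (Real.arctan_strictMono (by gcongr)) two_pos
  have h1 := lintegral_image_eq_lintegral_abs_deriv_mul (s := Ioo x1 x2) measurableSet_Ioo
    (fun y _ => (hd y).hasDerivWithinAt) hmono.injective.injOn g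
  have habs : ∀ y : ℝ, |2 * ε / (ε ^ 2 + y ^ 2)| = 2 * ε / (ε ^ 2 + y ^ 2) := fun y =>
    abs_of_nonneg (by positivity)
  simp only [habs] at h1
  rw [← h1]
  refine lintegral_mono_set ?_
  rintro _ ⟨y, hy, rfl⟩
  exact ⟨hmono hy.1, hmono hy.2⟩

lemma measurable_mob (ε : ℝ) : Measurable (mob ε) := by
  unfold mob
  fun_prop

lemma sq_le_three {A B C η : ℝ} (hη : 0 < η) :
    A ^ 2 ≤ (1 + 2 * η) * ((A - B) ^ 2 / η + (B - C) ^ 2 / η + C ^ 2) := by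
  have key : (1 + 2 * η) * ((A - B) ^ 2 / η + (B - C) ^ 2 / η + C ^ 2) - A ^ 2
      = ((A - B) - η * C) ^ 2 / η + ((B - C) - η * C) ^ 2 / η + ((A - B) - (B - C)) ^ 2 := by
    field_simp; ring
  have : 0 ≤ ((A - B) - η * C) ^ 2 / η + ((B - C) - η * C) ^ 2 / η + ((A - B) - (B - C)) ^ 2 := by
    positivity
  linarith

lemma neumann_or_periodic {c x δ : ℝ} (hcase : (c = Real.pi ∧ x = δ) ∨ (c = 0 ∧ x = 0))
    (g g' : ℝ → ℝ) (hg : ∀ x, HasDerivAt g (g' x) x) (hg' : Continuous g')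
    (hp : Function.Periodic g (2 * Real.pi)) :
    (∫ x in -Real.pi..c, g x ^ 2) - (∫ x in -Real.pi..c, g x) ^ 2 / (c - -Real.pi)
      ≤ ∫ x in -Real.pi..c, g' x ^ 2 := by
  rcases hcase with ⟨rfl, -⟩ | ⟨rfl, -⟩
  · have := wirtinger_periodic hg hg' hp
    rwa [sub_neg_eq_add, ← two_mul]
  · have := wirtinger_neumann (-Real.pi) hg hg'
    rw [neg_add_cancel] at this
    rwa [zero_sub, neg_neg]

lemma strip_image_energy {Q : ℂ → ℝ} (hQ : ContDiff ℝ 1 Q) {ε η δ c x2 : ℝ} (hε : 0 < ε)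
    (hη : 0 < η) (hδ : 0 < δ) (hcase : (c = Real.pi ∧ x2 = δ) ∨ (c = 0 ∧ x2 = 0))
    (hεδ : ε * 2 / (1 - Real.exp (-η)) ≤ δ) :
    (∫⁻ z in Iio (-η) ×ℂ Ioo (-Real.pi) c,
        (‖fderiv ℝ (fun z => Q (mob ε z)) z‖₊ : ℝ≥0∞) ^ 2)
      + ∫⁻ z in {z : ℂ | z.im ∈ Ioo (2 * Real.arctan (-δ / ε)) (2 * Real.arctan (x2 / ε)) ∧
          -η < z.re ∧ z.re < 0}, (‖fderiv ℝ (fun z => Q (mob ε z)) z‖₊ : ℝ≥0∞) ^ 2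
      ≤ ∫⁻ z in {z : ℂ | z.im ∈ Ioo (-δ) x2 ∧ z.re < 0}, (‖fderiv ℝ Q z‖₊ : ℝ≥0∞) ^ 2 := by
  have hpi := Real.pi_pos
  have hcπ : c ≤ Real.pi := by rcases hcase with ⟨rfl, -⟩ | ⟨rfl, -⟩ <;> linarith
  set S1 : Set ℂ := Iio (-η) ×ℂ Ioo (-Real.pi) c with hS1
  set S2 : Set ℂ := {z : ℂ | z.im ∈ Ioo (2 * Real.arctan (-δ / ε)) (2 * Real.arctan (x2 / ε)) ∧
          -η < z.re ∧ z.re < 0} with hS2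
  have m1 : MeasurableSet S1 :=
    (Complex.measurable_re measurableSet_Iio).inter (Complex.measurable_im measurableSet_Ioo)
  have m2 : MeasurableSet S2 :=
    (Complex.measurable_im measurableSet_Ioo).inter
      ((measurableSet_lt measurable_const Complex.measurable_re).inter
        (measurableSet_lt Complex.measurable_re measurable_const))
  have hdisj : Disjoint S1 S2 := by
    rw [Set.disjoint_left]
    rintro z hz hz'
    have h1 : z.re < -η := hz.1
    have h2 : -η < z.re := hz'.2.1
    linarith
  rw [← lintegral_union m2 hdisj]
  have hs1 : ∀ z ∈ S1, z ∈ piStrip := fun z hz => ⟨hz.2.1, hz.2.2.trans_le hcπ⟩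
  have hs2 : ∀ z ∈ S2, z ∈ piStrip := fun z hz =>
    ⟨by linarith [hz.1.1, Real.neg_pi_div_two_lt_arctan (-δ / ε)],
      by linarith [hz.1.2, Real.arctan_lt_pi_div_two (x2 / ε)]⟩
  have hs : ∀ z ∈ S1 ∪ S2, z ∈ piStrip := fun z hz => hz.elim (hs1 z) (hs2 z)
  refine (conformal_energy_le (m1.union m2) (fun z hz => hasDerivAt_mob ε (hs z hz))
    ((injOn_mob hε).mono hs) fun z _ => (hQ.differentiable one_ne_zero).differentiableAt).trans
    (lintegral_mono_set ?_)
  rintro _ ⟨z, hz, rfl⟩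
  have hre : z.re < 0 := by
    rcases hz with hz | hz
    · have : z.re < -η := hz.1
      linarith
    · exact hz.2.2
  refine ⟨?_, mob_re_neg hε (hs z hz) hre⟩
  have habs : |(mob ε z).im| < δ := by
    rcases hz with hz | hz
    · exact (abs_mob_im_lt_of_re_lt hε hη hz.1).trans_le hεδ
    · refine (abs_mob_im_le hε (hs2 z hz)).trans_lt ?_
      have hx2 : x2 ≤ δ := by rcases hcase with ⟨-, rfl⟩ | ⟨-, rfl⟩ <;> linarith
      have h1 : |z.im / 2| < Real.arctan (δ / ε) := by
        rw [abs_lt]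
        have e1 := hz.1.1
        have e2 := hz.1.2
        rw [neg_div, Real.arctan_neg] at e1
        have e3 : Real.arctan (x2 / ε) ≤ Real.arctan (δ / ε) :=
          Real.arctan_strictMono.monotone (by gcongr)
        constructor <;> linarith
      have h2 : |Real.tan (z.im / 2)| < δ / ε := by
        have h3 : ∀ t : ℝ, t ∈ Ioo (-(Real.pi / 2)) (Real.pi / 2) → t < Real.arctan (δ / ε) →
            Real.tan t < δ / ε := by
          intro t ht htl
          by_contra! hcon
          have := Real.arctan_strictMono.monotone hcon
          rw [Real.arctan_tan ht.1 ht.2] at this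
          linarith
        have h4 := Real.arctan_lt_pi_div_two (δ / ε)
        obtain ⟨h5, h6⟩ := abs_lt.1 h1
        rw [abs_lt]
        constructor
        · have := h3 (-(z.im / 2)) ⟨by linarith, by linarith⟩ (by linarith)
          rw [Real.tan_neg] at this
          linarith
        · exact h3 _ ⟨by linarith, by linarith⟩ h6
      calc ε * |Real.tan (z.im / 2)| < ε * (δ / ε) := by gcongr
        _ = δ := by field_simp
  refine ⟨(abs_lt.1 habs).1, ?_⟩
  rcases hcase with ⟨rfl, rfl⟩ | ⟨rfl, rfl⟩
  · exact (abs_lt.1 habs).2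
  · refine mob_im_neg hε (hs z hz) ?_
    rcases hz with hz | hz
    · exact hz.2.2
    · simpa using hz.1.2

lemma piece_inequality {Q : ℂ → ℝ} (hQ : ContDiff ℝ 1 Q) {ε η δ κ c x2 : ℝ} {h : ℝ → ℝ}
    (hε : 0 < ε) (hη : 0 < η) (hδ : 0 < δ)
    (hcase : (c = Real.pi ∧ x2 = δ) ∨ (c = 0 ∧ x2 = 0))
    (hεδ : ε * 2 / (1 - Real.exp (-η)) ≤ δ) (hh : Measurable h) (h0 : ∀ y, 0 ≤ h y)
    (hκ : ∀ y, h y ≤ κ) (hκε : 2 * κ / ε ≤ η)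
    (hmean : ∫ y in -Real.pi..c, Q (mob ε ((-η : ℝ) + y * Complex.I)) = 0) :
    ∫⁻ y in Ioo (-δ) x2,
        ENNReal.ofReal (2 * ε / (ε ^ 2 + y ^ 2) * Q (h y + y * Complex.I) ^ 2)
      ≤ ENNReal.ofReal (1 + 2 * η) * ∫⁻ z in {z : ℂ | z.im ∈ Ioo (-δ) x2 ∧ z.re < h z.im},
        (‖fderiv ℝ Q z‖₊ : ℝ≥0∞) ^ 2 := by
  have hpi := Real.pi_pos
  set u : ℂ → ℝ := fun z => Q (mob ε z) with hu
  have huc : ContDiffOn ℝ 1 u piStrip := hQ.comp_contDiffOn (contDiffOn_mob ε)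
  have hum : Measurable u := hQ.continuous.measurable.comp (measurable_mob ε)
  set β1 := 2 * Real.arctan (-δ / ε) with hβ1
  set β2 := 2 * Real.arctan (x2 / ε) with hβ2
  have hβ1' : -Real.pi < β1 := by linarith [Real.neg_pi_div_two_lt_arctan (-δ / ε)]
  have hβ2' : β2 < Real.pi := by linarith [Real.arctan_lt_pi_div_two (x2 / ε)]
  have hβ2c : β2 ≤ c := by
    rcases hcase with ⟨rfl, -⟩ | ⟨rfl, rfl⟩
    · exact hβ2'.le
    · simp [hβ2]
  set R1 := ∫⁻ z in Iio (-η) ×ℂ Ioo (-Real.pi) c, (‖fderiv ℝ u z‖₊ : ℝ≥0∞) ^ 2 with hR1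
  set R2 := ∫⁻ z in {z : ℂ | z.im ∈ Ioo β1 β2 ∧ -η < z.re ∧ z.re < 0},
    (‖fderiv ℝ u z‖₊ : ℝ≥0∞) ^ 2 with hR2
  set R3 := ∫⁻ z in {z : ℂ | z.im ∈ Ioo (-δ) x2 ∧ 0 < z.re ∧ z.re < h z.im},
    (‖fderiv ℝ Q z‖₊ : ℝ≥0∞) ^ 2 with hR3
  set R := ∫⁻ z in {z : ℂ | z.im ∈ Ioo (-δ) x2 ∧ z.re < h z.im},
        (‖fderiv ℝ Q z‖₊ : ℝ≥0∞) ^ 2 with hR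
  have hmfu : Measurable fun z => (‖fderiv ℝ u z‖₊ : ℝ≥0∞) ^ 2 := by
    have := measurable_fderiv ℝ u
    fun_prop
  have hmfQ : Measurable fun z => (‖fderiv ℝ Q z‖₊ : ℝ≥0∞) ^ 2 := by
    have := measurable_fderiv ℝ Q
    fun_prop
  have hsum : R1 + R2 + R3 ≤ R := by
    refine (add_le_add_left (strip_image_energy hQ hε hη hδ hcase hεδ) _).trans ?_
    have m3 : MeasurableSet {z : ℂ | z.im ∈ Ioo (-δ) x2 ∧ 0 < z.re ∧ z.re < h z.im} :=
      (Complex.measurable_im measurableSet_Ioo).inter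
        ((measurableSet_lt measurable_const Complex.measurable_re).inter
          (measurableSet_lt Complex.measurable_re (hh.comp Complex.measurable_im)))
    have hdisj : Disjoint {z : ℂ | z.im ∈ Ioo (-δ) x2 ∧ z.re < 0}
        {z : ℂ | z.im ∈ Ioo (-δ) x2 ∧ 0 < z.re ∧ z.re < h z.im} := by
      rw [Set.disjoint_left]
      rintro z hz hz'
      exact lt_asymm hz.2 hz'.2.1
    rw [← lintegral_union m3 hdisj]
    refine lintegral_mono_set ?_
    rintro z (hz | hz)
    · exact ⟨hz.1, hz.2.trans_le (h0 _)⟩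
    · exact ⟨hz.1, hz.2.2⟩
  have T1 : ∫⁻ β in Ioo (-Real.pi) c, ENNReal.ofReal (u ((-η : ℝ) + β * Complex.I) ^ 2) ≤ R1 := by
    refine strip_energy (P := fun w => Q (ε * ((w - 1) / (w + 1)))) ?_ hη ?_
      (neumann_or_periodic hcase) hmean
    · refine hQ.comp_contDiffOn (contDiffOn_const.mul (DifferentiableOn.contDiffOn (n := 1)
        (fun w hw => ?_) isOpen_ball |>.restrict_scalars ℝ))
      have hw1 : w + 1 ≠ 0 := by
        intro h
        rw [eq_neg_of_add_eq_zero_left h] at hw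
        simp at hw
      exact (((differentiableAt_id (𝕜 := ℂ)).sub_const 1).fun_div
        ((differentiableAt_id (𝕜 := ℂ)).add_const 1) hw1).differentiableWithinAt
    · rcases hcase with ⟨rfl, -⟩ | ⟨rfl, -⟩ <;> linarith
  have T2 : ∫⁻ β in Ioo β1 β2, ENNReal.ofReal ((u ((0 : ℝ) + β * Complex.I)
      - u ((-η : ℝ) + β * Complex.I)) ^ 2) ≤ ENNReal.ofReal η * R2 := by
    rw [hR2, setLIntegral_complex_between hmfu measurableSet_Ioo measurable_const
      measurable_const, ← lintegral_const_mul' _ _ ENNReal.ofReal_ne_top]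
    refine setLIntegral_mono' measurableSet_Ioo fun β hβ => ?_
    refine (horizontal_diff_le isOpen_piStrip huc (a := -η) (b := 0) (by linarith)
      fun x _ => ?_).trans_eq (by rw [zero_sub, neg_neg])
    constructor
    · simpa using hβ1'.trans hβ.1
    · simpa using hβ.2.trans hβ2'
  have T3 : ∫⁻ y in Ioo (-δ) x2, ENNReal.ofReal ((Q (h y + y * Complex.I)
      - Q ((0 : ℝ) + y * Complex.I)) ^ 2) ≤ ENNReal.ofReal κ * R3 := by
    rw [hR3, setLIntegral_complex_between hmfQ measurableSet_Ioo measurable_const hh,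
      ← lintegral_const_mul' _ _ ENNReal.ofReal_ne_top]
    refine setLIntegral_mono' measurableSet_Ioo fun y hy => ?_
    refine (horizontal_diff_le isOpen_univ hQ.contDiffOn (h0 y) fun _ _ => trivial).trans ?_
    rw [sub_zero]
    gcongr
    exact hκ y
  have hκ0 : 0 ≤ κ := (h0 0).trans (hκ 0)
  set D3 : ℝ → ℝ≥0∞ := fun y => ENNReal.ofReal ((Q (h y + y * Complex.I)
      - Q ((0 : ℝ) + y * Complex.I)) ^ 2) with hD3
  set D2 : ℝ → ℝ≥0∞ := fun β => ENNReal.ofReal ((u ((0 : ℝ) + β * Complex.I)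
      - u ((-η : ℝ) + β * Complex.I)) ^ 2) with hD2
  set D1 : ℝ → ℝ≥0∞ := fun β => ENNReal.ofReal (u ((-η : ℝ) + β * Complex.I) ^ 2) with hD1
  have mD3 : Measurable D3 := by
    have := hQ.continuous.measurable
    fun_prop
  have mD2 : Measurable D2 := by fun_prop
  have hpt : ∀ y : ℝ, ENNReal.ofReal (2 * ε / (ε ^ 2 + y ^ 2) * Q (h y + y * Complex.I) ^ 2)
      ≤ ENNReal.ofReal (1 + 2 * η) * (ENNReal.ofReal (2 / ε / η) * D3 y
        + ENNReal.ofReal (2 * ε / (ε ^ 2 + y ^ 2)) *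
          (ENNReal.ofReal (1 / η) * D2 (2 * Real.arctan (y / ε))
            + D1 (2 * Real.arctan (y / ε)))) := by
    intro y
    have hw0 : 0 ≤ 2 * ε / (ε ^ 2 + y ^ 2) := by positivity
    have hw : 2 * ε / (ε ^ 2 + y ^ 2) ≤ 2 / ε := by
      rw [div_le_div_iff₀ (by positivity) hε]; nlinarith [sq_nonneg y]
    simp only [hD1, hD2, hD3]
    rw [← ENNReal.ofReal_mul (p := 2 / ε / η) (by positivity),
      ← ENNReal.ofReal_mul (p := 1 / η) (by positivity),
      ← ENNReal.ofReal_add (by positivity) (by positivity), ← ENNReal.ofReal_mul hw0,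
      ← ENNReal.ofReal_add (by positivity) (by positivity), ← ENNReal.ofReal_mul (by positivity)]
    refine ENNReal.ofReal_le_ofReal ?_
    have e : u ((0 : ℝ) + (2 * Real.arctan (y / ε) : ℝ) * Complex.I)
        = Q ((0 : ℝ) + y * Complex.I) := by
      simp only [hu]
      rw [Complex.ofReal_zero, zero_add, mob_two_arctan hε, zero_add]
    rw [e]
    set A := Q (h y + y * Complex.I)
    set B := Q ((0 : ℝ) + y * Complex.I)
    set C := u ((-η : ℝ) + (2 * Real.arctan (y / ε) : ℝ) * Complex.I)
    set w := 2 * ε / (ε ^ 2 + y ^ 2)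
    calc w * A ^ 2 ≤ w * ((1 + 2 * η) * ((A - B) ^ 2 / η + (B - C) ^ 2 / η + C ^ 2)) := by
          gcongr; exact sq_le_three hη
      _ = (1 + 2 * η) * (w * ((A - B) ^ 2 / η) + w * (1 / η * (B - C) ^ 2 + C ^ 2)) := by ring
      _ ≤ (1 + 2 * η) * (2 / ε * ((A - B) ^ 2 / η) + w * (1 / η * (B - C) ^ 2 + C ^ 2)) := by
          gcongr
      _ = _ := by ring
  calc _ ≤ ∫⁻ y in Ioo (-δ) x2, ENNReal.ofReal (1 + 2 * η) * (ENNReal.ofReal (2 / ε / η) * D3 y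
        + ENNReal.ofReal (2 * ε / (ε ^ 2 + y ^ 2)) *
          (ENNReal.ofReal (1 / η) * D2 (2 * Real.arctan (y / ε))
            + D1 (2 * Real.arctan (y / ε)))) := lintegral_mono hpt
    _ = ENNReal.ofReal (1 + 2 * η) * (ENNReal.ofReal (2 / ε / η) * (∫⁻ y in Ioo (-δ) x2, D3 y)
        + ∫⁻ y in Ioo (-δ) x2, ENNReal.ofReal (2 * ε / (ε ^ 2 + y ^ 2)) *
          (ENNReal.ofReal (1 / η) * D2 (2 * Real.arctan (y / ε))
            + D1 (2 * Real.arctan (y / ε)))) := by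
        rw [lintegral_const_mul' _ _ ENNReal.ofReal_ne_top,
          lintegral_add_left (mD3.const_mul _), lintegral_const_mul _ mD3]
    _ ≤ ENNReal.ofReal (1 + 2 * η) * (ENNReal.ofReal (2 / ε / η) * (ENNReal.ofReal κ * R3)
        + ∫⁻ β in Ioo β1 β2, (ENNReal.ofReal (1 / η) * D2 β + D1 β)) := by
        refine mul_le_mul_right (add_le_add (mul_le_mul_right T3 _) ?_) _
        exact setLIntegral_two_arctan_le hε fun β => ENNReal.ofReal (1 / η) * D2 β + D1 β
    _ ≤ ENNReal.ofReal (1 + 2 * η) * (R3 + (R2 + R1)) := by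
        gcongr
        · rw [← mul_assoc, ← ENNReal.ofReal_mul (by positivity)]
          refine mul_le_of_le_one_left' (ENNReal.ofReal_le_one.2 ?_)
          rw [show 2 / ε / η * κ = (2 * κ / ε) / η by ring]
          exact (div_le_one hη).2 hκε
        · rw [lintegral_add_left (mD2.const_mul _), lintegral_const_mul _ mD2]
          refine add_le_add ?_ ((lintegral_mono_set (Ioo_subset_Ioo hβ1'.le hβ2c)).trans T1)
          refine (mul_le_mul_right T2 _).trans ?_
          rw [← mul_assoc, ← ENNReal.ofReal_mul (by positivity)]
          refine mul_le_of_le_one_left' (ENNReal.ofReal_le_one.2 ?_)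
          rw [one_div_mul_cancel hη.ne']
    _ ≤ _ := by
        gcongr
        rw [add_comm, add_comm R2 R1]
        exact hsum

/-- The standard identification of the Euclidean plane with `ℂ`. -/
def toC : E2 ≃ₗᵢ[ℝ] ℂ := Complex.orthonormalBasisOneI.repr.symm

lemma toC_re (x : E2) : (toC x).re = x 0 := by
  simp [toC, Complex.orthonormalBasisOneI_repr_symm_apply]

lemma toC_im (x : E2) : (toC x).im = x 1 := by
  simp [toC, Complex.orthonormalBasisOneI_repr_symm_apply]

lemma toC_symm_zero (z : ℂ) : toC.symm z 0 = z.re := by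
  rw [← toC_re, LinearIsometryEquiv.apply_symm_apply]

lemma toC_symm_one (z : ℂ) : toC.symm z 1 = z.im := by
  rw [← toC_im, LinearIsometryEquiv.apply_symm_apply]

/-- A domain which lies locally above cones over its points is locally a Lipschitz epigraph. -/
lemma exists_lipschitz_graph {Ω : Set E2} (hΩ : IsOpen Ω) {p : E2} (hp : p ∈ closure Ω)
    (e : E2 ≃ₗᵢ[ℝ] E2) (K : ℝ≥0) {r : ℝ} (hr : 0 < r)
    (hcone : ∀ x ∈ ball p r, x ∈ Ω → ∀ y ∈ ball p r,
      K * |e y 0 - e x 0| < e y 1 - e x 1 → y ∈ Ω) :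
    ∃ (φ : ℝ → ℝ) (U : Set E2), LipschitzWith K φ ∧ IsOpen U ∧ p ∈ U ∧
      ∀ x ∈ U, (x ∈ Ω ↔ φ (e x 0) < e x 1) := by
  set A : Set E2 := ball p r ∩ Ω with hA
  have hAne : Nonempty A := by
    obtain ⟨x, hx⟩ := mem_closure_iff_nhds.1 hp _ (ball_mem_nhds p hr)
    exact ⟨⟨x, hx⟩⟩
  have hlow : ∀ x : A, e p 1 - r ≤ e x.1 1 := by
    intro x
    have h1 : ‖e x.1 - e p‖ < r := by
      rw [← map_sub, LinearIsometryEquiv.norm_map, ← dist_eq_norm]; exact x.2.1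
    have h2 := (PiLp.norm_apply_le (e x.1 - e p) 1).trans_lt h1
    rw [Real.norm_eq_abs, PiLp.sub_apply] at h2
    linarith [(abs_lt.1 h2).1]
  set φ : ℝ → ℝ := fun s => ⨅ x : A, (e x.1 1 + K * |s - e x.1 0|) with hφ
  have hbdd : ∀ s, BddBelow (range fun x : A => e x.1 1 + K * |s - e x.1 0|) := by
    intro s
    refine ⟨e p 1 - r, ?_⟩
    rintro _ ⟨x, rfl⟩
    have : 0 ≤ K * |s - e x.1 0| := by positivity
    linarith [hlow x]
  refine ⟨φ, ball p r, ?_, isOpen_ball, mem_ball_self hr, fun x hx => ⟨fun hxΩ => ?_, fun h => ?_⟩⟩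
  · refine LipschitzWith.of_le_add_mul K fun s t => ?_
    rw [← sub_le_iff_le_add]
    refine le_ciInf fun x => ?_
    have h1 : φ s ≤ e x.1 1 + K * |s - e x.1 0| := ciInf_le (hbdd s) x
    have h2 : |s - e x.1 0| ≤ |t - e x.1 0| + dist s t := by
      rw [Real.dist_eq]
      calc |s - e x.1 0| = |(t - e x.1 0) + (s - t)| := by ring_nf
        _ ≤ _ := abs_add_le _ _
    nlinarith [K.2, mul_le_mul_of_nonneg_left h2 K.2]
  · have hcont : Continuous fun t : ℝ => e.symm (e x - t • EuclideanSpace.single 1 1) := by fun_prop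
    have hev : ∀ᶠ t in 𝓝[>] (0 : ℝ), e.symm (e x - t • EuclideanSpace.single 1 1) ∈ A := by
      refine (hcont.tendsto 0).mono_left nhdsWithin_le_nhds |>.eventually ?_
      refine (isOpen_ball.inter hΩ).mem_nhds ?_
      simpa using ⟨hx, hxΩ⟩
    obtain ⟨t, ht, ht0⟩ := (hev.and self_mem_nhdsWithin).exists
    have h1 := ciInf_le (hbdd (e x 0)) ⟨_, ht⟩
    refine lt_of_le_of_lt h1 ?_
    simpa using ht0
  · obtain ⟨y, hy⟩ := exists_lt_of_ciInf_lt h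
    exact hcone y.1 y.2.1 y.2.2 x hx (by linarith)

/-- The plane domain star-shaped about `0` whose boundary is `r = exp (h θ)` in polar
coordinates. -/
def starDom (h : ℝ → ℝ) : Set ℂ := {z | ‖z‖ < Real.exp (h z.arg)}

lemma apply_arg_exp {h : ℝ → ℝ} (hp : Function.Periodic h (2 * Real.pi)) (z : ℂ) :
    h (Complex.exp z).arg = h z.im := by
  rw [Complex.arg_exp, toIocMod, zsmul_eq_mul]
  exact hp.sub_int_mul_eq _

lemma exp_mem_starDom {h : ℝ → ℝ} (hp : Function.Periodic h (2 * Real.pi)) (z : ℂ) :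
    Complex.exp z ∈ starDom h ↔ z.re < h z.im := by
  rw [starDom, mem_ofPred_eq, apply_arg_exp hp, Complex.norm_exp, Real.exp_lt_exp]

lemma apply_arg_mul {h : ℝ → ℝ} (hp : Function.Periodic h (2 * Real.pi)) {z w : ℂ} (hz : z ≠ 0)
    (hw : w ≠ 0) : h (z * w).arg = h (z.arg + w.arg) := by
  rw [← Complex.exp_log hz, ← Complex.exp_log hw, ← Complex.exp_add, apply_arg_exp hp,
    Complex.exp_log hz, Complex.exp_log hw, Complex.add_im, Complex.log_im, Complex.log_im]

lemma continuousAt_apply_arg {h : ℝ → ℝ} (hc : Continuous h)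
    (hp : Function.Periodic h (2 * Real.pi)) {p : ℂ} (hp0 : p ≠ 0) :
    ContinuousAt (fun z : ℂ => h z.arg) p := by
  have h1 : ContinuousAt (fun z : ℂ => h (p.arg + (z / p).arg)) p := by
    refine hc.continuousAt.comp (continuousAt_const.add ?_)
    refine ContinuousAt.comp (f := fun z : ℂ => z / p) (g := Complex.arg) ?_ (by fun_prop)
    rw [div_self hp0]
    exact Complex.continuousAt_arg (by simp)
  refine h1.congr ?_
  filter_upwards [isOpen_ne.mem_nhds hp0] with z hz
  rw [← apply_arg_mul hp hp0 (div_ne_zero hz hp0), mul_div_cancel₀ _ hp0]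

lemma ball_subset_starDom {h : ℝ → ℝ} (h0 : ∀ x, 0 ≤ h x) : ball 0 1 ⊆ starDom h := by
  intro z hz
  rw [mem_ball_zero_iff] at hz
  exact hz.trans_le (Real.one_le_exp (h0 _))

lemma isOpen_starDom {h : ℝ → ℝ} (hc : Continuous h) (hp : Function.Periodic h (2 * Real.pi))
    (h0 : ∀ x, 0 ≤ h x) : IsOpen (starDom h) := by
  rw [isOpen_iff_mem_nhds]
  intro z hz
  rcases eq_or_ne z 0 with rfl | hz0
  · exact mem_of_superset (ball_mem_nhds _ one_pos) (ball_subset_starDom h0)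
  · exact continuous_norm.continuousAt.eventually_lt
      (Real.continuous_exp.continuousAt.comp (continuousAt_apply_arg hc hp hz0)) hz

lemma mem_starDom_smul {h : ℝ → ℝ} (h0 : ∀ x, 0 ≤ h x) {z : ℂ} {t : ℝ} (ht0 : 0 ≤ t)
    (ht : t < 1) (hz : ‖z‖ ≤ Real.exp (h z.arg)) : t • z ∈ starDom h := by
  rcases ht0.eq_or_lt with rfl | ht0
  · rw [zero_smul]; exact ball_subset_starDom h0 (mem_ball_self one_pos)
  · rw [starDom, mem_ofPred_eq, Complex.real_smul, Complex.arg_real_mul _ ht0, norm_mul,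
      Complex.norm_real, Real.norm_of_nonneg ht0.le]
    nlinarith [Real.exp_pos (h z.arg)]

lemma starConvex_starDom {h : ℝ → ℝ} (h0 : ∀ x, 0 ≤ h x) : StarConvex ℝ 0 (starDom h) := by
  rw [starConvex_zero_iff]
  intro z hz t ht0 ht1
  rcases ht1.eq_or_lt with rfl | ht1
  · rwa [one_smul]
  · exact mem_starDom_smul h0 ht0 ht1 (le_of_lt hz)

lemma mem_closure_starDom {h : ℝ → ℝ} (h0 : ∀ x, 0 ≤ h x) {z : ℂ}
    (hz : ‖z‖ ≤ Real.exp (h z.arg)) : z ∈ closure (starDom h) := by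
  have hc : Tendsto (fun t : ℝ => t • z) (𝓝[<] 1) (𝓝 z) := by
    have : Continuous fun t : ℝ => t • z := by fun_prop
    simpa using (this.tendsto 1).mono_left nhdsWithin_le_nhds
  refine mem_closure_of_tendsto hc ?_
  filter_upwards [Ioo_mem_nhdsLT (zero_lt_one (α := ℝ))] with t ht
  exact mem_starDom_smul h0 ht.1.le ht.2 hz

lemma mem_frontier_starDom {h : ℝ → ℝ} (hc : Continuous h)
    (hp : Function.Periodic h (2 * Real.pi)) (h0 : ∀ x, 0 ≤ h x) {z : ℂ} :
    z ∈ frontier (starDom h) ↔ ‖z‖ = Real.exp (h z.arg) := by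
  rw [(isOpen_starDom hc hp h0).frontier_eq]
  constructor
  · rintro ⟨h1, h2⟩
    refine le_antisymm ?_ (not_lt.1 h2)
    by_contra! hlt
    have hz0 : z ≠ 0 := by
      rintro rfl
      rw [norm_zero] at hlt
      exact (Real.exp_pos _).not_gt hlt
    have hev : ∀ᶠ w in 𝓝 z, Real.exp (h w.arg) < ‖w‖ :=
      (Real.continuous_exp.continuousAt.comp (continuousAt_apply_arg hc hp hz0)).eventually_lt
        continuous_norm.continuousAt hlt
    obtain ⟨w, hw1, hw2⟩ := mem_closure_iff_nhds.1 h1 _ hev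
    exact lt_asymm hw1 (show ‖w‖ < _ from hw2)
  · intro hz
    exact ⟨mem_closure_starDom h0 hz.le, fun h1 => (ne_of_lt h1) hz⟩

lemma abs_arg_le_pi_mul {w : ℂ} (hre : 0 ≤ w.re) (hw : 1 / 2 ≤ ‖w‖) :
    |w.arg| ≤ Real.pi * |w.im| := by
  have h1 := Real.mul_abs_le_abs_sin (Complex.abs_arg_le_pi_div_two_iff.2 hre)
  rw [Complex.sin_arg, abs_div, abs_norm] at h1
  have hpi := Real.pi_pos
  have h2 : |w.im| / ‖w‖ ≤ 2 * |w.im| := by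
    rw [div_le_iff₀ (by linarith)]
    nlinarith [abs_nonneg w.im]
  have h3 : 2 / Real.pi * |w.arg| ≤ 2 * |w.im| := h1.trans h2
  rw [div_mul_eq_mul_div, div_le_iff₀ hpi] at h3
  linarith

lemma norm_le_exp_of_cone {Q : ℝ} (hQ : 0 ≤ Q) {ξ : ℂ} (h1 : ‖ξ‖ ≤ 1 / 2)
    (h2 : (2 * Real.pi * Q + 1) * |ξ.im| ≤ ξ.re) :
    ‖1 - ξ‖ ≤ Real.exp (-(Q * |(1 - ξ).arg|)) := by
  have hpi := Real.pi_pos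
  have him := abs_nonneg ξ.im
  have hre : |ξ.re| ≤ 1 / 2 := (Complex.abs_re_le_norm ξ).trans h1
  have hle : |ξ.im| ≤ ξ.re := by
    nlinarith [mul_nonneg (mul_nonneg (mul_nonneg two_pos.le hpi.le) hQ) him]
  have hre0 : 0 ≤ ξ.re := him.trans hle
  rw [abs_of_nonneg hre0] at hre
  have harg : |(1 - ξ).arg| ≤ Real.pi * |ξ.im| := by
    have := abs_arg_le_pi_mul (w := 1 - ξ) (by simp; linarith) (by
      have := norm_sub_norm_le (1 : ℂ) ξ
      rw [norm_one] at this
      linarith)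
    simpa using this
  have hsq : ‖1 - ξ‖ ^ 2 ≤ Real.exp (-ξ.re) := by
    rw [← Complex.normSq_eq_norm_sq, Complex.normSq_apply]
    have h3 := Real.add_one_le_exp (-ξ.re)
    have h4 : ξ.im ^ 2 ≤ ξ.re ^ 2 := by rw [← sq_abs ξ.im]; gcongr
    simp only [Complex.sub_re, Complex.one_re, Complex.sub_im, Complex.one_im]
    nlinarith
  have h5 : ‖1 - ξ‖ ≤ Real.exp (-(ξ.re / 2)) := by
    refine le_of_sq_le_sq ?_ (Real.exp_pos _).le
    rw [← Real.exp_nat_mul]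
    refine hsq.trans_eq (congrArg _ ?_)
    push_cast; ring
  refine h5.trans (Real.exp_le_exp.2 (neg_le_neg ?_))
  calc Q * |(1 - ξ).arg| ≤ Q * (Real.pi * |ξ.im|) := by gcongr
    _ ≤ ξ.re / 2 := by linarith

lemma cone_mem_starDom {h : ℝ → ℝ} (hp : Function.Periodic h (2 * Real.pi)) {Q : ℝ≥0}
    (hQ : LipschitzWith Q h) {x ξ : ℂ} (hx0 : x ≠ 0) (hx : x ∈ starDom h) (h1 : ‖ξ‖ ≤ 1 / 2)
    (h2 : (2 * Real.pi * Q + 1) * |ξ.im| ≤ ξ.re) : x * (1 - ξ) ∈ starDom h := by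
  have hξ : 1 - ξ ≠ 0 := by
    intro h
    rw [← sub_eq_zero.1 h, norm_one] at h1
    norm_num at h1
  rw [starDom, mem_ofPred_eq, apply_arg_mul hp hx0 hξ, norm_mul]
  have h3 := norm_le_exp_of_cone Q.2 h1 h2
  have h4 : h x.arg - Q * |(1 - ξ).arg| ≤ h (x.arg + (1 - ξ).arg) := by
    have := hQ.dist_le_mul x.arg (x.arg + (1 - ξ).arg)
    rw [Real.dist_eq, Real.dist_eq, sub_add_cancel_left, abs_neg] at this
    linarith [le_abs_self (h x.arg - h (x.arg + (1 - ξ).arg))]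
  refine lt_of_lt_of_le ?_ (Real.exp_le_exp.2 h4)
  rw [sub_eq_add_neg (h x.arg), Real.exp_add]
  have hx' : ‖x‖ < Real.exp (h x.arg) := hx
  calc ‖x‖ * ‖1 - ξ‖ < Real.exp (h x.arg) * ‖1 - ξ‖ := by
        have := norm_pos_iff.2 hξ
        gcongr
    _ ≤ _ := by gcongr; exact h3

lemma cone_perturb {K a b s t : ℝ} (hK : 1 ≤ K) (hab : 4 * K * |a| < b) (hs : 8 * K * |s| ≤ 1)
    (ht : 8 * K * |t| ≤ 1) : K * |b * t - a * (1 + s)| ≤ b * (1 + s) + a * t := by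
  have hb : 0 < b := lt_of_le_of_lt (by positivity) hab
  have ha0 := abs_nonneg a
  have hs0 := abs_nonneg s
  have ht0 := abs_nonneg t
  have ha1 : |a| ≤ b / 4 := by nlinarith
  have hs1 : |s| ≤ 1 / 8 := by nlinarith
  have ht1 : |t| ≤ 1 / 8 := by nlinarith
  have h1 : |b * t - a * (1 + s)| ≤ b * |t| + |a| * (9 / 8) := by
    refine (abs_sub _ _).trans ?_
    rw [abs_mul, abs_mul, abs_of_pos hb]
    gcongr
    exact (abs_add_le _ _).trans (by rw [abs_one]; linarith)
  have h2 : K * (b * |t| + |a| * (9 / 8)) ≤ b / 8 + 9 / 32 * b := by nlinarith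
  have h3 : |a * t| ≤ b / 32 := by
    rw [abs_mul]
    calc |a| * |t| ≤ b / 4 * (1 / 8) := by gcongr
      _ = b / 32 := by ring
  have h4 : 7 / 8 * b ≤ b * (1 + s) := by nlinarith [neg_abs_le s]
  have h5 : K * |b * t - a * (1 + s)| ≤ K * (b * |t| + |a| * (9 / 8)) := by gcongr
  linarith [neg_abs_le (a * t)]

lemma starDom_cone {h : ℝ → ℝ} (hp : Function.Periodic h (2 * Real.pi)) {Q : ℝ≥0}
    (hQ : LipschitzWith Q h) {q : ℂ} (hq : q ≠ 0) {x y : ℂ}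
    (hx : dist x q < ‖q‖ / (16 * (2 * Real.pi * Q + 1)))
    (hy : dist y q < ‖q‖ / (16 * (2 * Real.pi * Q + 1))) (hxS : x ∈ starDom h)
    (hxy : 4 * (2 * Real.pi * Q + 1) * |(-Complex.I * (starRingEnd ℂ q / ‖q‖) * (y - x)).re|
      < (-Complex.I * (starRingEnd ℂ q / ‖q‖) * (y - x)).im) : y ∈ starDom h := by
  have hpi := Real.pi_pos
  set K : ℝ := 2 * Real.pi * Q + 1 with hK
  have hK1 : 1 ≤ K := by
    have : 0 ≤ 2 * Real.pi * Q := by positivity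
    linarith
  have hqn : 0 < ‖q‖ := norm_pos_iff.2 hq
  rw [dist_eq_norm, lt_div_iff₀ (by positivity)] at hx hy
  have hx1 : ‖x - q‖ * 16 ≤ ‖q‖ := by nlinarith [norm_nonneg (x - q)]
  have hy1 : ‖y - q‖ * 16 ≤ ‖q‖ := by nlinarith [norm_nonneg (y - q)]
  have hxq : ‖q‖ ≤ ‖x‖ + ‖x - q‖ := by
    have := norm_sub_le x (x - q)
    rwa [sub_sub_cancel] at this
  have hxn : 0 < ‖x‖ := by linarith
  have hx0 : x ≠ 0 := norm_pos_iff.1 hxn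
  set v := -Complex.I * (starRingEnd ℂ q / ‖q‖) * (y - x) with hv
  set s := q / x - 1 with hs
  have hsn : 8 * K * ‖s‖ ≤ 1 := by
    rw [hs, div_sub_one hx0, norm_div, norm_sub_rev, mul_div_assoc', div_le_one hxn]
    nlinarith [norm_nonneg (x - q)]
  have hs1 : 8 * K * |s.re| ≤ 1 := le_trans (by gcongr; exact Complex.abs_re_le_norm s) hsn
  have hs2 : 8 * K * |s.im| ≤ 1 := le_trans (by gcongr; exact Complex.abs_im_le_norm s) hsn
  have hper := cone_perturb hK1 hxy hs1 hs2
  set ξ : ℂ := 1 - y / x with hξ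
  have hξx : x * (1 - ξ) = y := by rw [hξ]; field_simp; ring
  have hqq : starRingEnd ℂ q * q = (‖q‖ : ℂ) ^ 2 := Complex.conj_mul' q
  have hqn' : (‖q‖ : ℂ) ≠ 0 := by exact_mod_cast hqn.ne'
  have hξv : (‖q‖ : ℂ) * ξ = -Complex.I * v * (1 + s) := by
    rw [hv, hs, hξ]
    field_simp
    linear_combination (-(Complex.I ^ 2) * (y - x)) * hqq + (x - y) * (‖q‖ : ℂ) ^ 2 * Complex.I_sq
  have hre : ‖q‖ * ξ.re = v.im * (1 + s.re) + v.re * s.im := by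
    have := congrArg Complex.re hξv
    rw [Complex.re_ofReal_mul] at this
    rw [this]
    simp; ring
  have him : ‖q‖ * ξ.im = v.im * s.im - v.re * (1 + s.re) := by
    have := congrArg Complex.im hξv
    rw [Complex.im_ofReal_mul] at this
    rw [this]
    simp; ring
  rw [← hre, ← him, abs_mul, abs_of_pos hqn] at hper
  rw [← hξx]
  refine cone_mem_starDom hp hQ hx0 hxS ?_ ?_
  · rw [hξ, one_sub_div hx0, norm_div, div_le_iff₀ hxn]
    have := norm_sub_le (x - q) (y - q)
    rw [sub_sub_sub_cancel_right] at this
    linarith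
  · refine le_of_mul_le_mul_left ?_ hqn
    linarith

lemma isLipschitzDomain_starDom {h : ℝ → ℝ} (hp : Function.Periodic h (2 * Real.pi)) {Q : ℝ≥0}
    (hQ : LipschitzWith Q h) (h0 : ∀ x, 0 ≤ h x) {κ : ℝ} (hκ : ∀ x, h x ≤ κ) :
    IsLipschitzDomain (toC ⁻¹' starDom h) := by
  have hopen := isOpen_starDom hQ.continuous hp h0
  have hopen' : IsOpen (toC ⁻¹' starDom h) := hopen.preimage toC.continuous
  refine ⟨hopen', ⟨⟨0, ?_⟩, ?_⟩, ?_, fun P hP => ?_⟩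
  · rw [mem_preimage, map_zero]; exact ball_subset_starDom h0 (mem_ball_self one_pos)
  · have h1 : IsPreconnected (starDom h) :=
      ((starConvex_starDom h0).isPathConnected (ball_subset_starDom h0
        (mem_ball_self one_pos))).isConnected.isPreconnected
    have h2 := h1.image toC.symm toC.symm.continuous.continuousOn
    rwa [toC.symm.image_eq_preimage_symm] at h2
  · refine isBounded_iff_forall_norm_le.2 ⟨Real.exp κ, fun x hx => ?_⟩
    rw [← toC.norm_map]
    exact (le_of_lt hx).trans (Real.exp_le_exp.2 (hκ _))
  · have hqf : toC P ∈ frontier (starDom h) := by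
      have := toC.toHomeomorph.preimage_frontier (starDom h)
      rw [← mem_preimage]
      exact this.symm ▸ hP
    set q := toC P with hq
    have hqn : ‖q‖ = Real.exp (h q.arg) := (mem_frontier_starDom hQ.continuous hp h0).1 hqf
    have hq0 : q ≠ 0 := by
      rw [← norm_pos_iff, hqn]; exact Real.exp_pos _
    have hqn0 : 0 < ‖q‖ := norm_pos_iff.2 hq0
    have hc : ‖-Complex.I * (starRingEnd ℂ q / ‖q‖)‖ = 1 := by
      rw [norm_mul, norm_neg, Complex.norm_I, one_mul, norm_div, RCLike.norm_conj,
        Complex.norm_real, norm_norm, div_self hqn0.ne']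
    set c : Circle := ⟨-Complex.I * (starRingEnd ℂ q / ‖q‖), mem_sphere_zero_iff_norm.2 hc⟩ with hcd
    set e : E2 ≃ₗᵢ[ℝ] E2 := (toC.trans (rotation c)).trans toC.symm with he
    have he0 : ∀ x, e x 0 = (-Complex.I * (starRingEnd ℂ q / ‖q‖) * toC x).re := fun x => by
      simp only [he, LinearIsometryEquiv.trans_apply, toC_symm_zero, hcd]
      rfl
    have he1 : ∀ x, e x 1 = (-Complex.I * (starRingEnd ℂ q / ‖q‖) * toC x).im := fun x => by
      simp only [he, LinearIsometryEquiv.trans_apply, toC_symm_one, hcd]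
      rfl
    set K : ℝ≥0 := ⟨4 * (2 * Real.pi * Q + 1), by positivity⟩ with hK
    obtain ⟨φ, U, hφ⟩ := exists_lipschitz_graph hopen' (frontier_subset_closure hP) e K
      (r := ‖q‖ / (16 * (2 * Real.pi * Q + 1))) (by positivity) (by
        intro x hx hxΩ y hy hxy
        refine starDom_cone hp hQ hq0 (x := toC x) ?_ ?_ hxΩ ?_
        · rw [hq, toC.dist_map]; exact hx
        · rw [hq, toC.dist_map]; exact hy
        · rw [he0, he0, he1, he1] at hxy
          rw [mul_sub, Complex.sub_re, Complex.sub_im]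
          exact hxy)
    exact ⟨e, K, φ, U, hφ⟩

lemma rotBy_eq (θ : ℝ) (x : E2) : toC (rotBy θ x) = Complex.exp (θ * Complex.I) * toC x := by
  apply Complex.ext
  · rw [toC_re, Complex.mul_re, Complex.exp_ofReal_mul_I_re, Complex.exp_ofReal_mul_I_im,
      toC_re, toC_im]
    simp [rotBy]
  · rw [toC_im, Complex.mul_im, Complex.exp_ofReal_mul_I_re, Complex.exp_ofReal_mul_I_im,
      toC_re, toC_im]
    simp [rotBy]; ring

lemma reflX_eq (x : E2) : toC (reflX x) = starRingEnd ℂ (toC x) := by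
  apply Complex.ext
  · rw [toC_re, Complex.conj_re, toC_re]; simp [reflX]
  · rw [toC_im, Complex.conj_im, toC_im]; simp [reflX]

lemma rotate_mem_starDom {h : ℝ → ℝ} (hp : Function.Periodic h (2 * Real.pi)) {θ : ℝ}
    (hθ : Function.Periodic h θ) (z : ℂ) :
    Complex.exp (θ * Complex.I) * z ∈ starDom h ↔ z ∈ starDom h := by
  rcases eq_or_ne z 0 with rfl | hz
  · rw [mul_zero]
  · rw [← Complex.exp_log hz, ← Complex.exp_add, exp_mem_starDom hp, exp_mem_starDom hp]
    simp only [Complex.add_re, Complex.re_ofReal_mul, Complex.I_re, mul_zero, zero_add,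
      Complex.add_im, Complex.im_ofReal_mul, Complex.I_im, mul_one]
    rw [add_comm θ, hθ]

lemma conj_mem_starDom {h : ℝ → ℝ} (hp : Function.Periodic h (2 * Real.pi))
    (he : ∀ x, h (-x) = h x) (z : ℂ) :
    starRingEnd ℂ z ∈ starDom h ↔ z ∈ starDom h := by
  rcases eq_or_ne z 0 with rfl | hz
  · rw [map_zero]
  · rw [← Complex.exp_log hz, ← Complex.exp_conj, exp_mem_starDom hp, exp_mem_starDom hp,
      Complex.conj_re, Complex.conj_im, he]

lemma memFrakDp_starDom {p : ℕ} (hp0 : p ≠ 0) {h : ℝ → ℝ}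
    (hp : Function.Periodic h (2 * Real.pi / p)) {Q : ℝ≥0}
    (hQ : LipschitzWith Q h) (h0 : ∀ x, 0 ≤ h x) {κ : ℝ} (hκ : ∀ x, h x ≤ κ)
    (he : ∀ x, h (-x) = h x) (hz : h 0 = 0) (hπ : h Real.pi = 0) :
    MemFrakDp p (toC ⁻¹' starDom h) := by
  have hp' : Function.Periodic h (2 * Real.pi) := by
    have := hp.nat_mul p
    rwa [mul_div_cancel₀ _ (Nat.cast_ne_zero.2 hp0)] at this
  refine ⟨isLipschitzDomain_starDom hp' hQ h0 hκ, ?_, ?_, ?_, 1, one_pos, ?_⟩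
  · have hstar : StarConvex ℝ 0 (toC ⁻¹' starDom h) := by
      refine StarConvex.is_linear_preimage (f := toC) ?_ ⟨toC.map_add, toC.map_smul⟩
      rw [map_zero]
      exact starConvex_starDom h0
    have := hstar.contractibleSpace ⟨0, by
      rw [mem_preimage, map_zero]; exact ball_subset_starDom h0 (mem_ball_self one_pos)⟩
    infer_instance
  · ext x
    constructor
    · rintro ⟨y, hy, rfl⟩
      rw [mem_preimage, rotBy_eq, rotate_mem_starDom hp' hp]
      exact hy
    · intro hx
      refine ⟨rotBy (-(2 * Real.pi / p)) x, ?_, ?_⟩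
      · rw [mem_preimage, rotBy_eq, rotate_mem_starDom hp' hp.neg]
        exact hx
      · apply toC.injective
        rw [rotBy_eq, rotBy_eq, ← mul_assoc, ← Complex.exp_add]
        simp
  · ext x
    constructor
    · rintro ⟨y, hy, rfl⟩
      rw [mem_preimage, reflX_eq, conj_mem_starDom hp' he]
      exact hy
    · intro hx
      refine ⟨reflX x, ?_, ?_⟩
      · rw [mem_preimage, reflX_eq, conj_mem_starDom hp' he]
        exact hx
      · apply toC.injective
        rw [reflX_eq, reflX_eq, Complex.conj_conj]
  · ext x
    have hkey : x 1 = 0 → (x ∈ toC ⁻¹' starDom h ↔ |x 0| < 1) := by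
      intro hx1
      have hx : toC x = (x 0 : ℂ) := by
        apply Complex.ext
        · rw [toC_re, Complex.ofReal_re]
        · rw [toC_im, hx1, Complex.ofReal_im]
      have harg : h ((x 0 : ℂ)).arg = 0 := by
        rcases le_or_gt 0 (x 0) with h1 | h1
        · rw [Complex.arg_ofReal_of_nonneg h1, hz]
        · rw [Complex.arg_ofReal_of_neg h1, hπ]
      rw [mem_preimage, hx, starDom, mem_ofPred_eq, harg, Complex.norm_real, Real.exp_zero,
        Real.norm_eq_abs]
    constructor
    · rintro ⟨hx, hx1⟩
      exact ⟨hx1, abs_lt.1 ((hkey hx1).1 hx)⟩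
    · rintro ⟨hx1, hx⟩
      exact ⟨(hkey hx1).2 (abs_lt.2 hx), hx1⟩

/-- Distance to the nearest integer. -/
def distInt (x : ℝ) : ℝ := ‖(x : UnitAddCircle)‖

lemma distInt_nonneg (x : ℝ) : 0 ≤ distInt x := norm_nonneg _

lemma distInt_le_half (x : ℝ) : distInt x ≤ 1 / 2 := by
  have := AddCircle.norm_le_half_period (1 : ℝ) (x := (x : UnitAddCircle)) one_ne_zero
  simpa [distInt] using this

lemma distInt_neg (x : ℝ) : distInt (-x) = distInt x := by
  rw [distInt, distInt, AddCircle.coe_neg, norm_neg]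

lemma distInt_add_int (x : ℝ) (k : ℤ) : distInt (x + k) = distInt x := by
  have : ((k : ℝ) : UnitAddCircle) = 0 := by
    rw [AddCircle.coe_eq_zero_iff]; exact ⟨k, by simp⟩
  rw [distInt, distInt, AddCircle.coe_add, this, add_zero]

lemma distInt_add_nat (x : ℝ) (k : ℕ) : distInt (x + k) = distInt x := by
  exact_mod_cast distInt_add_int x k

lemma distInt_of_abs_le {x : ℝ} (hx : |x| ≤ 1 / 2) : distInt x = |x| := by
  rw [distInt, AddCircle.norm_coe_eq_abs_iff _ one_ne_zero]
  simpa using hx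

lemma abs_distInt_sub_le (x y : ℝ) : |distInt x - distInt y| ≤ |x - y| := by
  refine (abs_norm_sub_norm_le _ _).trans ?_
  rw [← AddCircle.coe_sub]
  exact QuotientAddGroup.norm_mk_le_norm

lemma continuous_distInt : Continuous distInt :=
  continuous_norm.comp (AddCircle.continuous_mk' 1)

/-- The periodised Poisson-type weight with peaks of width `ε` at the odd multiples of `δ`. -/
def toothDensity (δ ε θ : ℝ) : ℝ := 2 * ε / (ε ^ 2 + (2 * δ * distInt ((θ - δ) / (2 * δ))) ^ 2)

def toothPhase (δ ε W θ : ℝ) : ℝ := W * ∫ t in (0 : ℝ)..θ, toothDensity δ ε t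

def toothProfile (δ ε W n θ : ℝ) : ℝ := distInt (n * toothPhase δ ε W θ) / n

section
variable {δ ε W n : ℝ}

lemma continuous_toothDensity (hε : 0 < ε) : Continuous (toothDensity δ ε) := by
  have := continuous_distInt
  unfold toothDensity
  refine Continuous.div (by fun_prop) (by fun_prop) fun θ => ?_
  positivity

lemma toothDensity_pos (hε : 0 < ε) (θ : ℝ) : 0 < toothDensity δ ε θ := by
  unfold toothDensity; positivity

lemma toothDensity_le (hε : 0 < ε) (θ : ℝ) : toothDensity δ ε θ ≤ 2 / ε := by
  unfold toothDensity
  rw [div_le_div_iff₀ (by positivity) hε]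
  nlinarith [sq_nonneg (2 * δ * distInt ((θ - δ) / (2 * δ)))]

lemma le_toothDensity (hδ : 0 < δ) (hε : 0 < ε) (θ : ℝ) :
    2 * ε / (ε ^ 2 + δ ^ 2) ≤ toothDensity δ ε θ := by
  unfold toothDensity
  have h1 := distInt_le_half ((θ - δ) / (2 * δ))
  have h0 := distInt_nonneg ((θ - δ) / (2 * δ))
  have : 2 * δ * distInt ((θ - δ) / (2 * δ)) ≤ δ := by nlinarith
  gcongr

lemma toothDensity_add (hδ : 0 < δ) (θ : ℝ) :
    toothDensity δ ε (θ + 2 * δ) = toothDensity δ ε θ := by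
  have : (θ + 2 * δ - δ) / (2 * δ) = (θ - δ) / (2 * δ) + (1 : ℕ) := by
    push_cast; field_simp; ring
  rw [toothDensity, this, distInt_add_nat, toothDensity]

lemma toothDensity_neg (hδ : 0 < δ) (θ : ℝ) : toothDensity δ ε (-θ) = toothDensity δ ε θ := by
  have : (-θ - δ) / (2 * δ) = -((θ - δ) / (2 * δ) + (1 : ℕ)) := by
    push_cast; field_simp; ring
  rw [toothDensity, this, distInt_neg, distInt_add_nat, toothDensity]

lemma toothDensity_center (hδ : 0 < δ) (i : ℕ) {y : ℝ} (hy : |y| ≤ δ) :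
    toothDensity δ ε ((2 * i + 1) * δ + y) = 2 * ε / (ε ^ 2 + y ^ 2) := by
  have : ((2 * i + 1) * δ + y - δ) / (2 * δ) = y / (2 * δ) + i := by
    field_simp; ring
  rw [toothDensity, this, distInt_add_nat, distInt_of_abs_le, mul_pow, sq_abs]
  · congr 2; field_simp
  · rw [abs_div, abs_of_pos (by positivity : 0 < 2 * δ), div_le_iff₀ (by positivity)]
    linarith

lemma hasDerivAt_toothPhase (hε : 0 < ε) (θ : ℝ) :
    HasDerivAt (toothPhase δ ε W) (W * toothDensity δ ε θ) θ := by
  have hc := continuous_toothDensity (δ := δ) hε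
  exact (intervalIntegral.integral_hasDerivAt_right (hc.intervalIntegrable _ _)
    (hc.stronglyMeasurableAtFilter _ _) hc.continuousAt).const_mul W

lemma continuous_toothPhase (hε : 0 < ε) : Continuous (toothPhase δ ε W) :=
  continuous_iff_continuousAt.2 fun θ => (hasDerivAt_toothPhase hε θ).continuousAt

lemma toothPhase_zero : toothPhase δ ε W 0 = 0 := by simp [toothPhase]

lemma strictMono_toothPhase (hε : 0 < ε) (hW : 0 < W) : StrictMono (toothPhase δ ε W) :=
  strictMono_of_hasDerivAt_pos (fun θ => hasDerivAt_toothPhase hε θ)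
    fun θ => mul_pos hW (toothDensity_pos hε θ)

lemma lipschitzWith_toothPhase (hε : 0 < ε) (hW : 0 < W) :
    LipschitzWith (W * (2 / ε)).toNNReal (toothPhase δ ε W) := by
  refine lipschitzWith_of_nnnorm_deriv_le
    (fun θ => (hasDerivAt_toothPhase hε θ).differentiableAt) fun θ => ?_
  rw [(hasDerivAt_toothPhase hε θ).deriv, ← NNReal.coe_le_coe, coe_nnnorm, Real.norm_eq_abs,
    Real.coe_toNNReal _ (by positivity),
    abs_of_pos (mul_pos hW (toothDensity_pos hε θ))]
  exact mul_le_mul_of_nonneg_left (toothDensity_le hε θ) hW.le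

lemma toothPhase_neg (hδ : 0 < δ) (θ : ℝ) : toothPhase δ ε W (-θ) = -toothPhase δ ε W θ := by
  have := intervalIntegral.integral_comp_neg (a := 0) (b := -θ) (toothDensity δ ε)
  simp only [toothDensity_neg hδ, neg_neg, neg_zero] at this
  rw [toothPhase, this, intervalIntegral.integral_symm, toothPhase, mul_neg]

lemma toothPhase_add (hδ : 0 < δ) (hε : 0 < ε) (θ : ℝ) :
    toothPhase δ ε W (θ + 2 * δ) = toothPhase δ ε W θ + 4 * W * Real.arctan (δ / ε) := by
  have hc := continuous_toothDensity (δ := δ) hε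
  have h1 : (∫ t in (0 : ℝ)..(θ + 2 * δ), toothDensity δ ε t) =
      (∫ t in (0 : ℝ)..θ, toothDensity δ ε t) + ∫ t in θ..(θ + 2 * δ), toothDensity δ ε t :=
    (intervalIntegral.integral_add_adjacent_intervals (hc.intervalIntegrable _ _)
      (hc.intervalIntegrable _ _)).symm
  have h2 : (∫ t in θ..(θ + 2 * δ), toothDensity δ ε t) =
      ∫ t in (0 : ℝ)..(0 + 2 * δ), toothDensity δ ε t :=
    Function.Periodic.intervalIntegral_add_eq (toothDensity_add hδ) θ 0
  have h3 : (∫ y in (-δ)..δ, toothDensity δ ε (y + δ)) =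
      ∫ t in (0 : ℝ)..(0 + 2 * δ), toothDensity δ ε t := by
    rw [intervalIntegral.integral_comp_add_right]
    congr 1 <;> ring
  have h4 : (∫ y in (-δ)..δ, toothDensity δ ε (y + δ)) =
      ∫ y in (-δ)..δ, 2 * ε / (ε ^ 2 + y ^ 2) := by
    refine intervalIntegral.integral_congr fun y hy => ?_
    rw [uIcc_of_le (by linarith)] at hy
    have := toothDensity_center (ε := ε) hδ 0 (abs_le.2 hy)
    simpa [add_comm] using this
  have h5 : (∫ y in (-δ)..δ, 2 * ε / (ε ^ 2 + y ^ 2)) =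
      2 * Real.arctan (δ / ε) - 2 * Real.arctan (-δ / ε) := by
    refine intervalIntegral.integral_eq_sub_of_hasDerivAt
      (f := fun y => 2 * Real.arctan (y / ε)) (fun y _ => ?_) ?_
    · have := (((hasDerivAt_id y).div_const ε).arctan).const_mul 2
      have he : 2 * ε / (ε ^ 2 + y ^ 2) = 2 * (1 / (1 + (id y / ε) ^ 2) * (1 / ε)) := by
        rw [id]; field_simp
      rw [he]
      exact this
    · refine (Continuous.intervalIntegrable ?_ _ _)
      exact Continuous.div (by fun_prop) (by fun_prop) fun y => by positivity
  rw [toothPhase, h1, h2, ← h3, h4, h5, neg_div, Real.arctan_neg, toothPhase]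
  ring

lemma toothPhase_add_nat (hδ : 0 < δ) (hε : 0 < ε) (θ : ℝ) (m : ℕ) :
    toothPhase δ ε W (θ + m * (2 * δ)) =
      toothPhase δ ε W θ + m * (4 * W * Real.arctan (δ / ε)) := by
  induction m with
  | zero => simp
  | succ m ih =>
    have : θ + (m + 1 : ℕ) * (2 * δ) = θ + m * (2 * δ) + 2 * δ := by push_cast; ring
    rw [this, toothPhase_add hδ hε, ih]
    push_cast; ring

lemma toothPhase_nat_mul (hδ : 0 < δ) (hε : 0 < ε) (m : ℕ) :
    toothPhase δ ε W (m * δ) = m * (2 * W * Real.arctan (δ / ε)) := by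
  have h1 := toothPhase_add_nat (W := W) hδ hε (-(m * δ)) m
  rw [toothPhase_neg hδ] at h1
  have : -(m * δ) + m * (2 * δ) = m * δ := by ring
  rw [this] at h1
  linarith

lemma toothProfile_nonneg (hn : 0 < n) (θ : ℝ) : 0 ≤ toothProfile δ ε W n θ :=
  div_nonneg (distInt_nonneg _) hn.le

lemma toothProfile_le (hn : 0 < n) (θ : ℝ) : toothProfile δ ε W n θ ≤ 1 / (2 * n) := by
  rw [toothProfile, div_le_div_iff₀ hn (by positivity)]
  nlinarith [distInt_le_half (n * toothPhase δ ε W θ)]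

lemma abs_toothProfile_sub_le (hn : 0 < n) (a b : ℝ) :
    |toothProfile δ ε W n a - toothProfile δ ε W n b| ≤
      |toothPhase δ ε W a - toothPhase δ ε W b| := by
  rw [toothProfile, toothProfile, ← sub_div, abs_div, abs_of_pos hn, div_le_iff₀ hn]
  refine (abs_distInt_sub_le _ _).trans (le_of_eq ?_)
  rw [← mul_sub, abs_mul, abs_of_pos hn, mul_comm]

lemma lipschitzWith_toothProfile (hε : 0 < ε) (hW : 0 < W) (hn : 0 < n) :
    LipschitzWith (W * (2 / ε)).toNNReal (toothProfile δ ε W n) := by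
  refine LipschitzWith.of_dist_le_mul fun a b => ?_
  refine le_trans ?_ ((lipschitzWith_toothPhase (δ := δ) hε hW).dist_le_mul a b)
  rw [Real.dist_eq, Real.dist_eq]
  exact abs_toothProfile_sub_le hn a b

lemma toothProfile_neg (hδ : 0 < δ) (θ : ℝ) :
    toothProfile δ ε W n (-θ) = toothProfile δ ε W n θ := by
  rw [toothProfile, toothPhase_neg hδ, mul_neg, distInt_neg, toothProfile]

lemma toothProfile_periodic (hδ : 0 < δ) (hε : 0 < ε) {j : ℕ}
    (hj : n * (2 * W * Real.arctan (δ / ε)) = j) (m : ℕ) :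
    Function.Periodic (toothProfile δ ε W n) (m * (2 * δ)) := fun θ => by
  have : n * (toothPhase δ ε W θ + m * (4 * W * Real.arctan (δ / ε))) =
      n * toothPhase δ ε W θ + (2 * m * j : ℕ) := by
    push_cast; rw [← hj]; ring
  rw [toothProfile, toothPhase_add_nat hδ hε, this, distInt_add_nat, toothProfile]

lemma toothProfile_nat_mul (hδ : 0 < δ) (hε : 0 < ε) {j : ℕ}
    (hj : n * (2 * W * Real.arctan (δ / ε)) = j) (m : ℕ) :
    toothProfile δ ε W n (m * δ) = 0 := by
  have : n * (m * (2 * W * Real.arctan (δ / ε))) = 0 + (m * j : ℕ) := by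
    push_cast; rw [← hj]; ring
  rw [toothProfile, toothPhase_nat_mul hδ hε, this, distInt_add_nat, distInt_of_abs_le] <;> simp

end

lemma arg_exp_of_mem {z : ℂ} (h1 : -Real.pi < z.im) (h2 : z.im ≤ Real.pi) :
    (Complex.exp z).arg = z.im := by
  rw [← Complex.log_im, Complex.log_exp h1 h2]

lemma im_pos_of_arg {w : ℂ} (hw : w.arg ∈ Ioo 0 Real.pi) : 0 < w.im := by
  have hw0 : w ≠ 0 := by
    rintro rfl
    simp at hw
  rw [← Complex.norm_mul_sin_arg]
  exact mul_pos (norm_pos_iff.2 hw0) (Real.sin_pos_of_mem_Ioo hw)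

lemma measurableSet_starDom {h : ℝ → ℝ} (hh : Measurable h) : MeasurableSet (starDom h) :=
  measurableSet_lt measurable_norm (hh.comp Complex.measurable_arg).exp

lemma sector_inequality {F : ℂ → ℝ} (hF : ContDiff ℝ 1 F) {ε η δ κ c x2 θ : ℝ} {h : ℝ → ℝ}
    (hp : Function.Periodic h (2 * Real.pi))
    (hε : 0 < ε) (hη : 0 < η) (hδ : 0 < δ) (hδπ : δ ≤ Real.pi)
    (hcase : (c = Real.pi ∧ x2 = δ) ∨ (c = 0 ∧ x2 = 0))
    (hεδ : ε * 2 / (1 - Real.exp (-η)) ≤ δ) (hh : Measurable h) (h0 : ∀ y, 0 ≤ h y)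
    (hκ : ∀ y, h y ≤ κ) (hκε : 2 * κ / ε ≤ η) (hθ1 : 0 ≤ θ - δ) (hθ2 : θ + x2 ≤ Real.pi)
    (hmean : ∫ y in -Real.pi..c,
      F (Complex.exp (mob ε ((-η : ℝ) + y * Complex.I) + θ * Complex.I)) = 0) :
    ∫⁻ y in Ioo (-δ) x2, ENNReal.ofReal (2 * ε / (ε ^ 2 + y ^ 2) *
        F (Complex.exp (h (θ + y) + (θ + y : ℝ) * Complex.I)) ^ 2) ≤
      ENNReal.ofReal (1 + 2 * η) *
        ∫⁻ w in starDom h ∩ {w | w.arg ∈ Ioo (θ - δ) (θ + x2)},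
          (‖fderiv ℝ F w‖₊ : ℝ≥0∞) ^ 2 := by
  set Ψ : ℂ → ℂ := fun z => Complex.exp (z + θ * Complex.I) with hΨ
  have hΨd : ContDiff ℝ 1 Ψ := by
    have : ContDiff ℂ 1 Ψ := by fun_prop
    exact this.restrict_scalars ℝ
  have hx2 : x2 ≤ δ := by rcases hcase with h | h <;> linarith [h.2]
  have hmain := piece_inequality (Q := fun z => F (Ψ z)) (hF.comp hΨd) hε hη hδ hcase hεδ
    (h := fun y => h (θ + y)) (hh.comp (measurable_const_add θ)) (fun y => h0 _) (fun y => hκ _)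
    hκε hmean
  set S : Set ℂ := {z : ℂ | z.im ∈ Ioo (-δ) x2 ∧ z.re < h (θ + z.im)} with hS
  have hSm : MeasurableSet S :=
    (Complex.measurable_im measurableSet_Ioo).inter (measurableSet_lt Complex.measurable_re
      (hh.comp (Complex.measurable_im.const_add θ)))
  have hinj : InjOn Ψ S := by
    intro z hz w hw hzw
    simp only [hΨ, Complex.exp_add] at hzw
    have hzw := mul_right_cancel₀ (Complex.exp_ne_zero _) hzw
    exact Complex.exp_inj_of_neg_pi_lt_of_le_pi (by linarith [hz.1.1]) (by linarith [hz.1.2])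
      (by linarith [hw.1.1]) (by linarith [hw.1.2]) hzw
  have hconf := conformal_energy_le (Ψ := Ψ) (Ψ' := Ψ) hSm (fun z _ => by
    have := ((hasDerivAt_id z).add_const (θ * Complex.I)).cexp
    simpa [hΨ] using this) hinj (F := F) (fun z _ => (hF.differentiable one_ne_zero) _)
  have hsub : Ψ '' S ⊆ starDom h ∩ {w | w.arg ∈ Ioo (θ - δ) (θ + x2)} := by
    rintro _ ⟨z, hz, rfl⟩
    have him : (z + θ * Complex.I).im = θ + z.im := by simp [add_comm]
    refine ⟨?_, ?_⟩
    · rw [hΨ, exp_mem_starDom hp, him]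
      simpa using hz.2
    · rw [mem_ofPred_eq, hΨ, arg_exp_of_mem, him]
      · exact ⟨by linarith [hz.1.1], by linarith [hz.1.2]⟩
      · rw [him]; linarith [hz.1.1, Real.pi_pos]
      · rw [him]; linarith [hz.1.2]
  calc _ = ∫⁻ y in Ioo (-δ) x2, ENNReal.ofReal (2 * ε / (ε ^ 2 + y ^ 2) *
        F (Ψ ((h (θ + y) : ℝ) + y * Complex.I)) ^ 2) := by
        refine lintegral_congr fun y => ?_
        have : ((h (θ + y) : ℝ) : ℂ) + y * Complex.I + θ * Complex.I =
          h (θ + y) + (θ + y : ℝ) * Complex.I := by push_cast; ring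
        simp only [hΨ, this]
    _ ≤ _ := hmain
    _ ≤ _ := by
        exact mul_le_mul' le_rfl (hconf.trans (lintegral_mono_set hsub))

/-- Right endpoint, in the strip variable, of the mean-value contour of the `i`-th sector: the
last sector is a half sector when `K` is odd. -/
def contourEnd (K i : ℕ) : ℝ := if 2 * i + 1 = K then 0 else Real.pi

/-- Contour average of `F` attached to the `i`-th sector. -/
def contourMean (K : ℕ) (δ ε η : ℝ) (i : ℕ) (F : ℂ → ℝ) : ℝ :=
  ∫ y in -Real.pi..contourEnd K i,
    F (Complex.exp (mob ε ((-η : ℝ) + y * Complex.I) + ((2 * i + 1) * δ : ℝ) * Complex.I))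

lemma weighted_boundary_le {F : ℂ → ℝ} (hF : ContDiff ℝ 1 F) {ε η δ κ : ℝ} {K : ℕ} {h : ℝ → ℝ}
    (hp : Function.Periodic h (2 * Real.pi))
    (hε : 0 < ε) (hη : 0 < η) (hδ : 0 < δ) (hK : K * δ = Real.pi)
    (hεδ : ε * 2 / (1 - Real.exp (-η)) ≤ δ) (hh : Measurable h) (h0 : ∀ y, 0 ≤ h y)
    (hκ : ∀ y, h y ≤ κ) (hκε : 2 * κ / ε ≤ η)
    (hmean : ∀ i < (K + 1) / 2, contourMean K δ ε η i F = 0) :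
    ∫⁻ t in Ioo 0 Real.pi, ENNReal.ofReal (toothDensity δ ε t *
        F (Complex.exp (h t + t * Complex.I)) ^ 2) ≤
      ENNReal.ofReal (1 + 2 * η) *
        ∫⁻ w in starDom h ∩ {w | 0 < w.im}, (‖fderiv ℝ F w‖₊ : ℝ≥0∞) ^ 2 := by
  have hK0 : 1 ≤ K := by
    rcases Nat.eq_zero_or_pos K with rfl | h
    · simp at hK; exact absurd hK Real.pi_pos.ne
    · exact h
  have hδπ : δ ≤ Real.pi := by
    rw [← hK]; exact le_mul_of_one_le_left hδ.le (by exact_mod_cast hK0)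
  set g : ℝ → ℝ≥0∞ := fun t => ENNReal.ofReal (toothDensity δ ε t *
        F (Complex.exp (h t + t * Complex.I)) ^ 2) with hg
  set θ : ℕ → ℝ := fun i => (2 * i + 1) * δ with hθ
  set x2 : ℕ → ℝ := fun i => if 2 * i + 1 = K then 0 else δ with hx2
  set S : ℕ → Set ℂ := fun i => starDom h ∩ {w | w.arg ∈ Ioo (θ i - δ) (θ i + x2 i)} with hS
  have hx2le : ∀ i, x2 i ≤ δ := fun i => by
    simp only [hx2]; split_ifs <;> linarith
  have hx2n : ∀ i, 0 ≤ x2 i := fun i => by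
    simp only [hx2]; split_ifs <;> linarith
  have hend : ∀ i < (K + 1) / 2, θ i + x2 i ≤ Real.pi := fun i hi => by
    simp only [hθ, hx2, ← hK]
    split_ifs with hiK
    · rw [← hiK]; push_cast; linarith
    · have : (2 * i + 2 : ℝ) ≤ K := by
        have : 2 * i + 2 ≤ K := by omega
        exact_mod_cast this
      nlinarith
  have hθ1 : ∀ i, 0 ≤ θ i - δ := fun i => by
    simp only [hθ]
    have : (0 : ℝ) ≤ i := Nat.cast_nonneg i
    nlinarith
  have hpiece : ∀ i < (K + 1) / 2, ∫⁻ t in Ioc (θ i - δ) (θ i + x2 i), g t ≤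
      ENNReal.ofReal (1 + 2 * η) * ∫⁻ w in S i, (‖fderiv ℝ F w‖₊ : ℝ≥0∞) ^ 2 := fun i hi => by
    have h1 := sector_inequality hF (c := contourEnd K i) (x2 := x2 i) (θ := θ i) hp hε hη hδ hδπ
      (by
        simp only [hx2, contourEnd]
        split_ifs
        · exact Or.inr ⟨rfl, rfl⟩
        · exact Or.inl ⟨rfl, rfl⟩) hεδ hh h0 hκ hκε (hθ1 i) (hend i hi) (hmean i hi)
    refine le_trans (le_of_eq ?_) h1
    rw [setLIntegral_congr Ioo_ae_eq_Ioc.symm]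
    have h2 := (measurePreserving_add_left volume (θ i)).setLIntegral_comp_preimage_emb
      (measurableEmbedding_addLeft (θ i)) g (Ioo (θ i - δ) (θ i + x2 i))
    rw [← h2]
    have h3 : (fun x => θ i + x) ⁻¹' Ioo (θ i - δ) (θ i + x2 i) = Ioo (-δ) (x2 i) := by
      rw [preimage_const_add_Ioo]; congr 1 <;> ring
    rw [h3]
    refine setLIntegral_congr_fun measurableSet_Ioo fun y hy => ?_
    simp only [hg, hθ]
    rw [toothDensity_center hδ i (abs_le.2 ⟨hy.1.le, hy.2.le.trans (hx2le i)⟩)]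
  have hcover : Ioo 0 Real.pi ⊆ ⋃ i ∈ Finset.range ((K + 1) / 2),
      Ioc (θ i - δ) (θ i + x2 i) := by
    intro t ht
    obtain ⟨i, hi⟩ : ∃ i : ℕ, ⌈t / (2 * δ)⌉₊ = i + 1 :=
      Nat.exists_eq_succ_of_ne_zero (Nat.ceil_pos.2 (by have := ht.1; positivity)).ne'
    have h1 : t ≤ (i + 1) * (2 * δ) := by
      have := Nat.le_ceil (t / (2 * δ))
      rw [hi, div_le_iff₀ (by positivity)] at this
      exact_mod_cast this
    have h2 : i * (2 * δ) < t := by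
      have := (Nat.lt_ceil (n := i) (a := t / (2 * δ))).1 (by omega)
      rwa [lt_div_iff₀ (by positivity)] at this
    have h3 : 2 * i < K := by
      have : (2 * i : ℝ) < K := by
        refine lt_of_mul_lt_mul_right ?_ hδ.le
        rw [hK]; linarith [ht.2]
      exact_mod_cast this
    refine mem_biUnion (x := i) (by simp only [Finset.coe_range, mem_Iio]; omega) ⟨?_, ?_⟩
    · simp only [hθ]; linarith
    · simp only [hθ, hx2]
      split_ifs with hiK
      · have := ht.2.le
        rw [← hK, ← hiK] at this
        push_cast at this; linarith
      · linarith
  have hSm : ∀ i, MeasurableSet (S i) := fun i =>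
    (measurableSet_starDom hh).inter (Complex.measurable_arg measurableSet_Ioo)
  have hdisj : Pairwise (Function.onFun Disjoint S) := by
    have key : ∀ i j : ℕ, i < j → Disjoint (S i) (S j) := fun i j hij => by
      rw [Set.disjoint_left]
      rintro w ⟨-, hw⟩ ⟨-, hw'⟩
      have h1 := hw.2
      have h2 := hw'.1
      have h3 := hx2le i
      have : (i + 1 : ℝ) ≤ j := by exact_mod_cast hij
      simp only [hθ] at h1 h2
      nlinarith
    intro i j hij
    rcases lt_or_gt_of_ne hij with h | h
    · exact key i j h
    · exact (key j i h).symm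
  calc ∫⁻ t in Ioo 0 Real.pi, g t
      ≤ ∫⁻ t in ⋃ i ∈ Finset.range ((K + 1) / 2), Ioc (θ i - δ) (θ i + x2 i), g t :=
        lintegral_mono_set hcover
    _ ≤ ∑ i ∈ Finset.range ((K + 1) / 2), ∫⁻ t in Ioc (θ i - δ) (θ i + x2 i), g t := by
        have := lintegral_iUnion_le (μ := volume)
          (fun i : Finset.range ((K + 1) / 2) => Ioc (θ i - δ) (θ i + x2 i)) g
        rw [tsum_fintype, Finset.univ_eq_attach, Finset.sum_attach (Finset.range ((K + 1) / 2))
          (fun i => ∫⁻ t in Ioc (θ i - δ) (θ i + x2 i), g t)] at this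
        refine le_trans (lintegral_mono_set (iUnion₂_subset fun i hi => ?_)) this
        exact subset_iUnion (fun i : Finset.range ((K + 1) / 2) =>
          Ioc (θ i - δ) (θ i + x2 i)) ⟨i, hi⟩
    _ ≤ ∑ i ∈ Finset.range ((K + 1) / 2),
          ENNReal.ofReal (1 + 2 * η) * ∫⁻ w in S i, (‖fderiv ℝ F w‖₊ : ℝ≥0∞) ^ 2 :=
        Finset.sum_le_sum fun i hi => hpiece i (Finset.mem_range.1 hi)
    _ = ENNReal.ofReal (1 + 2 * η) * ∫⁻ w in ⋃ i ∈ Finset.range ((K + 1) / 2), S i,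
          (‖fderiv ℝ F w‖₊ : ℝ≥0∞) ^ 2 := by
        rw [← Finset.mul_sum, lintegral_biUnion_finset (fun i _ j _ hij => hdisj hij)
          (fun i _ => hSm i)]
    _ ≤ _ := by
        gcongr
        refine iUnion₂_subset fun i hi w hw => ⟨hw.1, im_pos_of_arg ⟨?_, ?_⟩⟩
        · exact lt_of_le_of_lt (hθ1 i) hw.2.1
        · exact hw.2.2.trans_le (hend i (Finset.mem_range.1 hi))

lemma lintegral_hausdorff_image_le {γ : ℝ → E2} {X X' : ℝ → ℝ} {L : ℝ≥0} (hγ : Continuous γ)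
    (hX : ∀ t, HasDerivAt X (X' t) t) (hXm : StrictMono X) (hX'0 : ∀ t, 0 ≤ X' t)
    (hX'c : Continuous X') (hL : ∀ a b, dist (γ a) (γ b) ≤ L * |X a - X b|) {I : Set ℝ}
    (hI : MeasurableSet I) {g : E2 → ℝ≥0∞} (hg : Measurable g) :
    ∫⁻ x in γ '' I, g x ∂μH[1] ≤ L * ∫⁻ t in I, ENNReal.ofReal (X' t) * g (γ t) := by
  set ν : Measure ℝ := (volume.restrict I).withDensity (fun t => ENNReal.ofReal (X' t)) with hν
  have hm : Measurable fun t => ENNReal.ofReal (X' t) := hX'c.measurable.ennreal_ofReal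
  have hle : (μH[1] : Measure E2).restrict (γ '' I) ≤ (L : ℝ≥0∞) • ν.map γ := by
    refine Measure.le_iff.2 fun B hB => ?_
    set A : Set ℝ := I ∩ γ ⁻¹' B with hA
    have hAm : MeasurableSet A := hI.inter (hγ.measurable hB)
    have hlip : LipschitzOnWith L (γ ∘ Function.invFun X) (X '' A) := by
      refine LipschitzOnWith.of_dist_le_mul ?_
      rintro _ ⟨a, -, rfl⟩ _ ⟨b, -, rfl⟩
      rw [Function.comp_apply, Function.comp_apply, Function.leftInverse_invFun hXm.injective,
        Function.leftInverse_invFun hXm.injective]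
      exact hL a b
    have h1 := hlip.hausdorffMeasure_image_le (d := 1) zero_le_one
    have h2 : (γ ∘ Function.invFun X) '' (X '' A) = γ '' A := by
      rw [← image_comp]
      refine image_congr fun a _ => ?_
      rw [Function.comp, Function.comp, Function.leftInverse_invFun hXm.injective]
    have h3 : μH[1] (X '' A) = ∫⁻ t in A, ENNReal.ofReal (X' t) := by
      rw [hausdorffMeasure_real]
      have := lintegral_image_eq_lintegral_abs_deriv_mul hAm
        (fun t _ => (hX t).hasDerivWithinAt) hXm.injective.injOn (fun _ => 1)
      simp only [mul_one, setLIntegral_one] at this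
      rw [this]
      simp only [abs_of_nonneg (hX'0 _)]
    rw [h2, h3, ENNReal.rpow_one] at h1
    rw [Measure.restrict_apply hB, inter_comm, ← image_inter_preimage]
    refine h1.trans (le_of_eq ?_)
    rw [Measure.smul_apply, Measure.map_apply hγ.measurable hB,
      withDensity_apply _ (hγ.measurable hB), Measure.restrict_restrict (hγ.measurable hB),
      inter_comm, smul_eq_mul]
  calc ∫⁻ x in γ '' I, g x ∂μH[1] ≤ ∫⁻ x, g x ∂((L : ℝ≥0∞) • ν.map γ) :=
        lintegral_mono' hle le_rfl
    _ = L * ∫⁻ t in I, ENNReal.ofReal (X' t) * g (γ t) := by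
        rw [lintegral_smul_measure, lintegral_map hg hγ.measurable, hν,
          lintegral_withDensity_eq_lintegral_mul _ hm
            (show Measurable fun t => g (γ t) from hg.comp hγ.measurable), smul_eq_mul]
        rfl

lemma norm_exp_sub_exp_le {κ : ℝ} {z w : ℂ} (hz : z.re ≤ κ) (hw : w.re ≤ κ) :
    ‖Complex.exp z - Complex.exp w‖ ≤ Real.exp κ * ‖z - w‖ := by
  refine Convex.norm_image_sub_le_of_norm_hasDerivWithin_le (s := {z : ℂ | z.re ≤ κ})
    (f' := Complex.exp) (fun x _ => (Complex.hasDerivAt_exp x).hasDerivWithinAt)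
    (fun x hx => ?_) (convex_halfSpace_re_le κ) hw hz
  rw [Complex.norm_exp]
  exact Real.exp_le_exp.2 hx

/-- Polar parametrisation of the boundary of `toC ⁻¹' starDom h`. -/
def polarCurve (h : ℝ → ℝ) (t : ℝ) : E2 := toC.symm (Complex.exp (h t + t * Complex.I))

lemma toC_polarCurve (h : ℝ → ℝ) (t : ℝ) :
    toC (polarCurve h t) = Complex.exp (h t + t * Complex.I) := by
  rw [polarCurve, LinearIsometryEquiv.apply_symm_apply]

lemma continuous_polarCurve {h : ℝ → ℝ} (hh : Continuous h) : Continuous (polarCurve h) := by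
  unfold polarCurve
  exact toC.symm.continuous.comp (by fun_prop)

lemma arg_polarCurve (h : ℝ → ℝ) {t : ℝ} (ht : t ∈ Ioo 0 Real.pi) :
    (toC (polarCurve h t)).arg = t := by
  rw [toC_polarCurve, arg_exp_of_mem] <;> simp [ht.2.le]
  linarith [ht.1, Real.pi_pos]

lemma norm_polarCurve (h : ℝ → ℝ) (t : ℝ) : ‖polarCurve h t‖ = Real.exp (h t) := by
  rw [← toC.norm_map, toC_polarCurve, Complex.norm_exp]
  simp

lemma dist_polarCurve_le {h : ℝ → ℝ} {κ : ℝ} (hκ : ∀ x, h x ≤ κ) (a b : ℝ) :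
    dist (polarCurve h a) (polarCurve h b) ≤ Real.exp κ * (|h a - h b| + |a - b|) := by
  rw [← toC.dist_map, toC_polarCurve, toC_polarCurve, dist_eq_norm]
  refine (norm_exp_sub_exp_le (κ := κ) (by simpa using hκ a) (by simpa using hκ b)).trans ?_
  gcongr
  refine (Complex.norm_le_abs_re_add_abs_im _).trans (le_of_eq ?_)
  simp

lemma upper_frontier_starDom {h : ℝ → ℝ} (hc : Continuous h)
    (hp : Function.Periodic h (2 * Real.pi)) (h0 : ∀ x, 0 ≤ h x) :
    frontier (toC ⁻¹' starDom h) ∩ {x : E2 | 0 < x 1} = polarCurve h '' Ioo 0 Real.pi := by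
  have hfr : ∀ x : E2, x ∈ frontier (toC ⁻¹' starDom h) ↔ ‖toC x‖ = Real.exp (h (toC x).arg) := by
    intro x
    rw [← mem_frontier_starDom hc hp h0, ← mem_preimage]
    exact iff_of_eq (congrArg (x ∈ ·) (toC.toHomeomorph.preimage_frontier (starDom h)).symm)
  ext x
  constructor
  · rintro ⟨hx, hx1⟩
    rw [mem_ofPred_eq, ← toC_im] at hx1
    refine ⟨(toC x).arg, ⟨?_, ?_⟩, ?_⟩
    · have h1 := Complex.arg_nonneg_iff.2 hx1.le
      refine lt_of_le_of_ne h1 fun h2 => ?_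
      exact hx1.ne' (Complex.arg_eq_zero_iff.1 h2.symm).2
    · exact Complex.arg_lt_pi_iff.2 (Or.inr hx1.ne')
    · apply toC.injective
      rw [toC_polarCurve, Complex.exp_add, ← Complex.ofReal_exp, ← (hfr x).1 hx,
        Complex.norm_mul_exp_arg_mul_I]
  · rintro ⟨t, ht, rfl⟩
    refine ⟨?_, ?_⟩
    · rw [hfr, arg_polarCurve h ht, toC.norm_map, norm_polarCurve]
    · rw [mem_ofPred_eq, ← toC_im]
      exact im_pos_of_arg (by rwa [arg_polarCurve h ht])

lemma dirEnergy_toC_preimage (S : Set ℂ) {f : E2 → ℝ} (hf : Differentiable ℝ f) :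
    dirEnergy (toC ⁻¹' S) f = ∫⁻ w in S, (‖fderiv ℝ (fun w => f (toC.symm w)) w‖₊ : ℝ≥0∞) ^ 2 := by
  have hmp : MeasurePreserving toC := toC.measurePreserving
  rw [← hmp.setLIntegral_comp_preimage_emb toC.toHomeomorph.measurableEmbedding]
  refine lintegral_congr fun x => ?_
  have h1 : fderiv ℝ (fun w => f (toC.symm w)) (toC x) =
      (fderiv ℝ f x).comp (toC.symm.toContinuousLinearEquiv : ℂ →L[ℝ] E2) := by
    have h2 := (toC.symm.toContinuousLinearEquiv : ℂ →L[ℝ] E2).hasFDerivAt (x := toC x)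
    have h3 : HasFDerivAt f (fderiv ℝ f x) (toC.symm (toC x)) := by
      rw [LinearIsometryEquiv.symm_apply_apply]
      exact (hf x).hasFDerivAt
    exact (h3.comp (toC x) h2).fderiv
  have h4 : ‖fderiv ℝ (fun w => f (toC.symm w)) (toC x)‖ = ‖fderiv ℝ f x‖ := by
    rw [h1]
    exact ContinuousLinearMap.opNorm_comp_linearIsometryEquiv _ _
  rw [show ‖fderiv ℝ (fun w => f (toC.symm w)) (toC x)‖₊ = ‖fderiv ℝ f x‖₊ from NNReal.eq h4]

lemma teeth_length {δ ε W n : ℝ} {M : ℕ} (hε : 0 < ε) (hn : 0 < n)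
    (hM : n * toothPhase δ ε W Real.pi = M) :
    ENNReal.ofReal (toothPhase δ ε W Real.pi) ≤
      μH[1] (polarCurve (toothProfile δ ε W n) '' Ioo 0 Real.pi) := by
  set H := toothPhase δ ε W with hH
  set h := toothProfile δ ε W n with hh
  set Γ := polarCurve h '' Ioo 0 Real.pi with hΓ
  have hHc : Continuous H := continuous_toothPhase hε
  set T : ℕ → Set E2 := fun l =>
    {x | n * H (toC x).arg ∈ Ioo ((l : ℝ) / 2) ((l + 1 : ℝ) / 2)} with hT
  have hTm : ∀ l, MeasurableSet (T l) := fun l =>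
    ((hHc.measurable.comp (Complex.measurable_arg.comp toC.continuous.measurable)).const_mul n)
      measurableSet_Ioo
  have hTd : Pairwise (Function.onFun Disjoint T) := by
    have key : ∀ i j : ℕ, i < j → Disjoint (T i) (T j) := fun i j hij => by
      rw [Set.disjoint_left]
      intro x hx hx'
      have h1 := hx.2
      have h2 := hx'.1
      have : (i + 1 : ℝ) ≤ j := by exact_mod_cast hij
      linarith
    intro i j hij
    rcases lt_or_gt_of_ne hij with h | h
    · exact key i j h
    · exact (key j i h).symm
  have hpiece : ∀ l < 2 * M, ENNReal.ofReal (1 / (2 * n)) ≤ μH[1].restrict Γ (T l) := by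
    intro l hl
    rw [Measure.restrict_apply (hTm l)]
    have h1 : Ioo 1 (Real.exp (1 / (2 * n))) ⊆ norm '' (T l ∩ Γ) := by
      intro r hr
      have hr0 : 0 < r := by linarith [hr.1]
      have hlog0 : 0 < Real.log r := Real.log_pos hr.1
      have hlog1 : Real.log r < 1 / (2 * n) := (Real.log_lt_iff_lt_exp hr0).2 hr.2
      have hs1 : n * Real.log r < 1 / 2 := by
        rw [lt_div_iff₀ (by positivity)] at hlog1
        linarith
      have hs0 : 0 < n * Real.log r := by positivity
      have hdist : distInt (n * Real.log r) = n * Real.log r := by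
        rw [distInt_of_abs_le] <;> rw [abs_of_pos hs0]
        exact hs1.le
      obtain ⟨s, hs, hsd⟩ : ∃ s ∈ Ioo ((l : ℝ) / 2) ((l + 1 : ℝ) / 2),
          distInt s = n * Real.log r := by
        rcases Nat.even_or_odd' l with ⟨a, rfl | rfl⟩
        · refine ⟨n * Real.log r + a, ⟨?_, ?_⟩, by rw [distInt_add_nat, hdist]⟩ <;>
            push_cast <;> linarith
        · refine ⟨-(n * Real.log r) + (a + 1 : ℕ), ⟨?_, ?_⟩,
            by rw [distInt_add_nat, distInt_neg, hdist]⟩ <;> push_cast <;> linarith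
      have hsM : s ∈ Ioo (n * H 0) (n * H Real.pi) := by
        rw [hM, hH, toothPhase_zero, mul_zero]
        refine ⟨lt_of_le_of_lt (by positivity) hs.1, hs.2.trans_le ?_⟩
        have : (l + 1 : ℝ) ≤ 2 * M := by exact_mod_cast hl
        linarith
      obtain ⟨t, ht, hts⟩ := intermediate_value_Ioo Real.pi_pos.le
        (f := fun t => n * H t) (by fun_prop) hsM
      refine ⟨polarCurve h t, ⟨?_, t, ht, rfl⟩, ?_⟩
      · rw [hT, mem_ofPred_eq, arg_polarCurve h ht]
        rwa [← hts] at hs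
      · rw [norm_polarCurve, hh, toothProfile]
        change Real.exp (distInt (n * H t) / n) = r
        rw [show n * H t = s from hts, hsd, mul_div_cancel_left₀ _ hn.ne', Real.exp_log hr0]
    have h2 := (lipschitzWith_one_norm (E := E2)).hausdorffMeasure_image_le (d := 1) zero_le_one
      (T l ∩ Γ)
    rw [ENNReal.coe_one, ENNReal.one_rpow, one_mul, hausdorffMeasure_real] at h2
    refine le_trans ?_ h2
    refine le_trans ?_ (measure_mono h1)
    rw [Real.volume_Ioo]
    exact ENNReal.ofReal_le_ofReal (by linarith [Real.add_one_le_exp (1 / (2 * n))])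
  have hsum := sum_measure_le_measure_univ (μ := μH[1].restrict Γ) (s := Finset.range (2 * M))
    (t := T) (fun i _ => (hTm i).nullMeasurableSet) (fun i _ j _ hij => (hTd hij).aedisjoint)
  rw [Measure.restrict_apply_univ] at hsum
  refine le_trans ?_ hsum
  refine le_trans ?_ (Finset.card_nsmul_le_sum _ _ _ fun l hl => hpiece l (Finset.mem_range.1 hl))
  rw [Finset.card_range, nsmul_eq_mul, ← ENNReal.ofReal_natCast, ← ENNReal.ofReal_mul (by positivity)]
  refine ENNReal.ofReal_le_ofReal (le_of_eq ?_)
  push_cast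
  rw [← hM]
  field_simp

lemma continuous_mob_line {ε η : ℝ} (hη : 0 < η) :
    Continuous fun y : ℝ => mob ε ((-η : ℝ) + y * Complex.I) := by
  unfold mob
  refine continuous_const.mul (Continuous.div (by fun_prop) (by fun_prop) fun y h => ?_)
  have h1 := congrArg norm (eq_neg_of_add_eq_zero_left h)
  rw [Complex.norm_exp, norm_neg, norm_one] at h1
  simp at h1
  exact hη.ne' h1

/-- The contour averages as linear functionals on a space of continuous functions. -/
def contourMap (K : ℕ) (δ ε η : ℝ) (hη : 0 < η) (V : Submodule ℝ (E2 → ℝ))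
    (hV : ∀ f ∈ V, Continuous f) : V →ₗ[ℝ] (Fin ((K + 1) / 2) → ℝ) where
  toFun f i := contourMean K δ ε η i fun w => f.1 (toC.symm w)
  map_add' f g := by
    funext i
    have key : ∀ f : V, IntervalIntegrable (fun y : ℝ => f.1 (toC.symm (Complex.exp
        (mob ε ((-η : ℝ) + y * Complex.I) + ((2 * (i : ℕ) + 1) * δ : ℝ) * Complex.I))))
        volume (-Real.pi) (contourEnd K i) := fun f => by
      refine Continuous.intervalIntegrable ?_ _ _
      exact (hV f.1 f.2).comp (toC.symm.continuous.comp
        ((continuous_mob_line hη).add continuous_const).cexp)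
    exact intervalIntegral.integral_add (key f) (key g)
  map_smul' c f := by
    funext i
    exact intervalIntegral.integral_const_mul _ _

lemma dirEnergy_ne_top {Ω : Set E2} (hΩ : Bornology.IsBounded Ω) {f : E2 → ℝ}
    (hf : ContDiff ℝ 1 f) : dirEnergy Ω f ≠ ⊤ := by
  have hc : Continuous fun x => ‖fderiv ℝ f x‖₊ ^ 2 :=
    (hf.continuous_fderiv one_ne_zero).nnnorm.pow 2
  have h1 := setLIntegral_lt_top_of_isCompact (μ := volume)
    hΩ.isCompact_closure.measure_lt_top.ne hΩ.isCompact_closure hc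
  refine ((lintegral_mono_set subset_closure).trans_lt ?_).ne
  simpa using h1

lemma eq_zero_of_dirEnergy_eq_zero {Ω : Set E2} (hΩ : IsOpen Ω) {f : E2 → ℝ}
    (hf : ContDiff ℝ 1 f) (hE : dirEnergy Ω f = 0) {x : E2} (hx : ∀ c ∈ Ioo (0 : ℝ) 1, c • x ∈ Ω) :
    f x = f 0 := by
  have hc := hf.continuous_fderiv one_ne_zero
  have h0 : EqOn (fderiv ℝ f) 0 Ω := by
    refine Measure.eqOn_open_of_ae_eq (μ := volume) ?_ hΩ hc.continuousOn continuousOn_const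
    rw [dirEnergy, lintegral_eq_zero_iff (by fun_prop)] at hE
    filter_upwards [hE] with y hy
    simpa using hy
  have hd : ∀ c : ℝ, HasDerivAt (fun c : ℝ => f (c • x)) (fderiv ℝ f (c • x) x) c := fun c => by
    have h1 : HasDerivAt (fun c : ℝ => c • x) x c := by
      simpa using (hasDerivAt_id c).smul_const x
    exact (hf.differentiable one_ne_zero (c • x)).hasFDerivAt.comp_hasDerivAt c h1
  obtain ⟨c, hc, hcd⟩ := exists_hasDerivAt_eq_slope (fun c : ℝ => f (c • x)) _ zero_lt_one
    (fun c _ => (hd c).continuousAt.continuousWithinAt) fun c _ => hd c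
  rw [h0 (hx c hc)] at hcd
  simp at hcd
  linarith

section
variable {δ ε W n η : ℝ}

lemma dist_polarCurve_toothProfile_le (hε : 0 < ε) (hW : 0 < W) (hn : 0 < n) (a b : ℝ) :
    dist (polarCurve (toothProfile δ ε W n) a) (polarCurve (toothProfile δ ε W n) b) ≤
      Real.exp (1 / (2 * n)) * |(a + toothPhase δ ε W a) - (b + toothPhase δ ε W b)| := by
  refine (dist_polarCurve_le (toothProfile_le hn) a b).trans ?_
  gcongr
  refine (add_le_add_left (abs_toothProfile_sub_le hn a b) _).trans (le_of_eq ?_)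
  have key : ∀ a b : ℝ, a ≤ b → |toothPhase δ ε W a - toothPhase δ ε W b| + |a - b| =
      |(a + toothPhase δ ε W a) - (b + toothPhase δ ε W b)| := fun a b hab => by
    have := (strictMono_toothPhase (δ := δ) hε hW).monotone hab
    rw [abs_of_nonpos, abs_of_nonpos, abs_of_nonpos] <;> linarith
  rcases le_total a b with h | h
  · exact key a b h
  · rw [abs_sub_comm, abs_sub_comm a b, key b a h, abs_sub_comm]

lemma bdryInt_teeth_le (hδ : 0 < δ) (hε : 0 < ε) (hW : 0 < W) (hn : 0 < n) (hη : 0 < η)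
    (hWη : (ε ^ 2 + δ ^ 2) / (2 * ε) ≤ η * W) (hnη : Real.exp (1 / (2 * n)) ≤ 1 + η)
    {f : E2 → ℝ} (hf : Continuous f) :
    bdryInt (polarCurve (toothProfile δ ε W n) '' Ioo 0 Real.pi) (fun _ => 1) f ≤
      ENNReal.ofReal ((1 + η) ^ 2 * W) * ∫⁻ t in Ioo 0 Real.pi,
        ENNReal.ofReal (toothDensity δ ε t * f (polarCurve (toothProfile δ ε W n) t) ^ 2) := by
  have hρc := continuous_toothDensity (δ := δ) hε
  have h1 := lintegral_hausdorff_image_le (γ := polarCurve (toothProfile δ ε W n))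
    (X := fun t => t + toothPhase δ ε W t) (X' := fun t => 1 + W * toothDensity δ ε t)
    (L := (Real.exp (1 / (2 * n))).toNNReal)
    (continuous_polarCurve (lipschitzWith_toothProfile hε hW hn).continuous)
    (fun t => (hasDerivAt_id t).add (hasDerivAt_toothPhase hε t))
    (fun a b hab => add_lt_add hab (strictMono_toothPhase hε hW hab))
    (fun t => by have := toothDensity_pos (δ := δ) hε t; positivity) (by fun_prop)
    (fun a b => by
      rw [Real.coe_toNNReal _ (Real.exp_pos _).le]
      exact dist_polarCurve_toothProfile_le hε hW hn a b) (measurableSet_Ioo (a := 0) (b := Real.pi))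
    (g := fun x => ENNReal.ofReal (1 * f x ^ 2)) (by fun_prop)
  refine h1.trans ?_
  have h2 : ∀ t, ENNReal.ofReal (1 + W * toothDensity δ ε t) *
      ENNReal.ofReal (1 * f (polarCurve (toothProfile δ ε W n) t) ^ 2) ≤
      ENNReal.ofReal ((1 + η) * W) * ENNReal.ofReal (toothDensity δ ε t *
        f (polarCurve (toothProfile δ ε W n) t) ^ 2) := fun t => by
    have hρ := toothDensity_pos (δ := δ) hε t
    rw [← ENNReal.ofReal_mul (by positivity), ← ENNReal.ofReal_mul (by positivity)]
    refine ENNReal.ofReal_le_ofReal ?_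
    have h3 : 1 ≤ η * W * toothDensity δ ε t := by
      have := le_toothDensity hδ hε t
      calc (1 : ℝ) = (ε ^ 2 + δ ^ 2) / (2 * ε) * (2 * ε / (ε ^ 2 + δ ^ 2)) := by
            field_simp
        _ ≤ _ := by gcongr
    rw [one_mul, ← mul_assoc]
    refine mul_le_mul_of_nonneg_right ?_ (sq_nonneg _)
    linarith
  calc _ ≤ ENNReal.ofReal (1 + η) * ∫⁻ t in Ioo 0 Real.pi, ENNReal.ofReal ((1 + η) * W) *
        ENNReal.ofReal (toothDensity δ ε t *
          f (polarCurve (toothProfile δ ε W n) t) ^ 2) :=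
        mul_le_mul' (ENNReal.ofReal_le_ofReal hnη) (lintegral_mono h2)
    _ = _ := by
        rw [lintegral_const_mul' _ _ ENNReal.ofReal_ne_top, ← mul_assoc,
          ← ENNReal.ofReal_mul (by positivity)]
        congr 2
        ring

/-- Lower bound for the mixed eigenvalue of the toothed half-domain. -/
lemma le_steklovN_teeth {K j k : ℕ} (hδ : 0 < δ) (hK : K * δ = Real.pi) (hε : 0 < ε) (hη : 0 < η)
    (hεδ : ε * 2 / (1 - Real.exp (-η)) ≤ δ) (hW : 0 < W) (hn : 0 < n)
    (hWη : (ε ^ 2 + δ ^ 2) / (2 * ε) ≤ η * W) (hnη : Real.exp (1 / (2 * n)) ≤ 1 + η)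
    (hnε : 1 / n ≤ η * ε) (hj : n * (2 * W * Real.arctan (δ / ε)) = j)
    (hk : (K + 1) / 2 ≤ k) :
    ENNReal.ofReal (1 / ((1 + η) ^ 2 * (1 + 2 * η) * W)) ≤
      steklovN (toC ⁻¹' starDom (toothProfile δ ε W n) ∩ {x : E2 | 0 < x 1})
        (frontier (toC ⁻¹' starDom (toothProfile δ ε W n)) ∩ {x : E2 | 0 < x 1}) k := by
  set h := toothProfile δ ε W n with hh
  have hlip : LipschitzWith (W * (2 / ε)).toNNReal h := lipschitzWith_toothProfile hε hW hn
  have hhc : Continuous h := hlip.continuous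
  have h0 : ∀ x, 0 ≤ h x := toothProfile_nonneg hn
  have hp : Function.Periodic h (2 * Real.pi) := by
    have := toothProfile_periodic hδ hε hj K
    rwa [mul_left_comm, hK] at this
  set Ω : Set E2 := toC ⁻¹' starDom h ∩ {x : E2 | 0 < x 1} with hΩ
  have hΩo : IsOpen Ω :=
    ((isOpen_starDom hhc hp h0).preimage toC.continuous).inter
      (isOpen_lt continuous_const (by fun_prop))
  have hΩb : Bornology.IsBounded Ω :=
    (isLipschitzDomain_starDom hp hlip h0 (toothProfile_le hn)).2.2.1.subset inter_subset_left
  have hΩC : Ω = toC ⁻¹' (starDom h ∩ {w | 0 < w.im}) := by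
    ext x
    rw [hΩ, preimage_inter, mem_inter_iff, mem_inter_iff, mem_preimage, mem_preimage,
      mem_ofPred_eq, mem_ofPred_eq, toC_im]
  rw [upper_frontier_starDom hhc hp h0]
  unfold steklovN steklovMixed
  refine le_iInf fun V => le_iInf fun hdim => le_iInf fun hsm => le_iInf fun _ => le_iInf fun hinj => ?_
  have hsm1 : ∀ f ∈ V, ContDiff ℝ 1 f := fun f hf => (hsm f hf).of_le (by exact_mod_cast le_top)
  have : Module.Finite ℝ V := Module.finite_of_finrank_pos (by omega)
  have hker : LinearMap.ker (contourMap K δ ε η hη V fun f hf => (hsm f hf).continuous) ≠ ⊥ :=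
    LinearMap.ker_ne_bot_of_finrank_lt (by rw [hdim, Module.finrank_fin_fun]; omega)
  obtain ⟨⟨f, hfV⟩, hfk, hf0⟩ := Submodule.exists_mem_ne_zero_of_ne_bot hker
  have hmean : ∀ i < (K + 1) / 2, contourMean K δ ε η i (fun w => f (toC.symm w)) = 0 :=
    fun i hi => congrFun (LinearMap.mem_ker.1 hfk) ⟨i, hi⟩
  have hne : ¬ EqOn f 0 (closure Ω) := fun he => hf0 (Subtype.ext (hinj f hfV he))
  have hf1 := hsm1 f hfV
  refine le_trans ?_ (le_iSup₂_of_le f hfV (le_iSup_of_le hne le_rfl))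
  have hwb := weighted_boundary_le (F := fun w => f (toC.symm w)) (κ := 1 / (2 * n))
    (hf1.comp toC.symm.toContinuousLinearEquiv.contDiff) hp hε hη hδ hK hεδ hhc.measurable h0
    (toothProfile_le hn) (by
      rw [div_le_iff₀ hε]
      refine le_trans (le_of_eq ?_) hnε
      field_simp) hmean
  rw [← dirEnergy_toC_preimage _ (hf1.differentiable one_ne_zero), ← hΩC] at hwb
  have hB := bdryInt_teeth_le hδ hε hW hn hη hWη hnη hf1.continuous
  have hE0 : dirEnergy Ω f ≠ 0 := by
    intro hE
    refine hne ?_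
    have hconst := fun x => eq_zero_of_dirEnergy_eq_zero hΩo hf1 hE (x := x)
    have hγ : f (polarCurve h (Real.pi / 2)) = 0 := by
      rw [hE, mul_zero, nonpos_iff_eq_zero] at hwb
      have hc : Continuous fun t => ENNReal.ofReal (toothDensity δ ε t *
          f (polarCurve h t) ^ 2) := by
        have h1 := continuous_toothDensity (δ := δ) hε
        have h2 := hf1.continuous.comp (continuous_polarCurve hhc)
        exact ENNReal.continuous_ofReal.comp (h1.mul (h2.pow 2))
      have hz := (lintegral_eq_zero_iff hc.measurable).1 hwb
      have hz' := Measure.eqOn_open_of_ae_eq hz isOpen_Ioo hc.continuousOn continuousOn_const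
        (show Real.pi / 2 ∈ Ioo 0 Real.pi from ⟨by positivity, by linarith [Real.pi_pos]⟩)
      simp only [Pi.zero_apply, ENNReal.ofReal_eq_zero] at hz'
      have h3 := toothDensity_pos (δ := δ) hε (Real.pi / 2)
      by_contra h4
      have : 0 < f (polarCurve h (Real.pi / 2)) ^ 2 := by positivity
      nlinarith
    have hγ0 : f 0 = 0 := by
      rw [← hγ]
      refine (hconst _ fun c hc => ⟨?_, ?_⟩).symm
      · have harg : (toC (c • polarCurve h (Real.pi / 2))).arg =
            (toC (polarCurve h (Real.pi / 2))).arg := by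
          rw [map_smul, Complex.real_smul, Complex.arg_real_mul _ hc.1]
        rw [mem_preimage, starDom, mem_ofPred_eq, harg,
          arg_polarCurve h ⟨by positivity, by linarith [Real.pi_pos]⟩, toC.norm_map, norm_smul,
          norm_polarCurve, Real.norm_of_nonneg hc.1.le]
        exact mul_lt_of_lt_one_left (Real.exp_pos _) hc.2
      · have h1 : 0 < (toC (polarCurve h (Real.pi / 2))).im :=
          im_pos_of_arg (by
            rw [arg_polarCurve h ⟨by positivity, by linarith [Real.pi_pos]⟩]
            exact ⟨by positivity, by linarith [Real.pi_pos]⟩)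
        rw [toC_im] at h1
        exact mul_pos hc.1 h1
    have hΩ0 : EqOn f 0 Ω := fun x hx => by
      rw [hconst x fun c hc => ⟨?_, mul_pos hc.1 hx.2⟩, hγ0]
      · rfl
      · rw [mem_preimage, map_smul]
        exact (starConvex_starDom h0).smul_mem hx.1 hc.1.le hc.2.le
    exact hΩ0.closure hf1.continuous continuous_const
  have hET := dirEnergy_ne_top hΩb hf1
  rw [rayleigh, ENNReal.le_div_iff_mul_le (Or.inr hE0) (Or.inr hET)]
  calc _ ≤ ENNReal.ofReal (1 / ((1 + η) ^ 2 * (1 + 2 * η) * W)) *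
        (ENNReal.ofReal ((1 + η) ^ 2 * W) *
          (ENNReal.ofReal (1 + 2 * η) * dirEnergy Ω f)) := by
        refine mul_le_mul' le_rfl (hB.trans (mul_le_mul' le_rfl hwb))
    _ = dirEnergy Ω f := by
        rw [← mul_assoc, ← mul_assoc, ← ENNReal.ofReal_mul (by positivity),
          ← ENNReal.ofReal_mul (by positivity)]
        have : 1 / ((1 + η) ^ 2 * (1 + 2 * η) * W) * ((1 + η) ^ 2 * W) * (1 + 2 * η) = 1 := by
          field_simp
        rw [this, ENNReal.ofReal_one, one_mul]

end

lemma le_SfrakP_of_teeth {p m k : ℕ} (hp : p ≠ 0) (hm : m ≠ 0) (hk : (m * p + 1) / 2 ≤ k) {η : ℝ}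
    (hη : 0 < η) :
    ENNReal.ofReal (2 * (m * p) * Real.arctan (2 * η⁻¹) / ((1 + η) ^ 2 * (1 + 2 * η))) ≤
      SfrakP p k := by
  have hp' : (0 : ℝ) < p := by positivity
  have hm' : (0 : ℝ) < m := by positivity
  set δ : ℝ := Real.pi / (m * p) with hδd
  have hδ : 0 < δ := div_pos Real.pi_pos (by positivity)
  have hK : (m * p : ℕ) * δ = Real.pi := by
    rw [hδd]; push_cast; field_simp
  have he1 : 0 < 1 - Real.exp (-η) := by
    rw [sub_pos, ← Real.exp_zero, Real.exp_lt_exp]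
    exact neg_lt_zero.2 hη
  have he2 : 1 - Real.exp (-η) ≤ η := by linarith [Real.add_one_le_exp (-η)]
  set ε : ℝ := δ * (1 - Real.exp (-η)) / 2 with hεd
  have hε : 0 < ε := by positivity
  have hεδ : ε * 2 / (1 - Real.exp (-η)) ≤ δ := by
    rw [hεd]
    refine le_of_eq ?_
    field_simp
  have hratio : 2 * η⁻¹ ≤ δ / ε := by
    rw [hεd, ← div_eq_mul_inv, div_le_div_iff₀ hη (by positivity)]
    nlinarith
  set W : ℝ := (ε ^ 2 + δ ^ 2) / (2 * ε) / η with hWd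
  have hW : 0 < W := by positivity
  have hWη : (ε ^ 2 + δ ^ 2) / (2 * ε) ≤ η * W := by
    rw [hWd, mul_div_cancel₀ _ hη.ne']
  set P : ℝ := 2 * W * Real.arctan (δ / ε) with hPd
  have hP : 0 < P := by
    have : 0 < Real.arctan (δ / ε) := Real.arctan_pos.2 (by positivity)
    positivity
  obtain ⟨j, hjl⟩ := exists_nat_gt (P * (1 / (η * ε) + 1 / (2 * Real.log (1 + η))))
  have hlog : 0 < Real.log (1 + η) := Real.log_pos (by linarith)
  set n : ℝ := j / P with hnd
  have hnl : 1 / (η * ε) + 1 / (2 * Real.log (1 + η)) < n := by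
    rw [hnd, lt_div_iff₀ hP, mul_comm]; exact hjl
  have hn1 : 1 / (η * ε) < n := lt_of_le_of_lt (by
    have : 0 < 1 / (2 * Real.log (1 + η)) := by positivity
    linarith) hnl
  have hn2 : 1 / (2 * Real.log (1 + η)) < n := lt_of_le_of_lt (by
    have : 0 < 1 / (η * ε) := by positivity
    linarith) hnl
  have hn : 0 < n := lt_trans (by positivity) hn1
  have hnε : 1 / n ≤ η * ε := by
    rw [div_le_iff₀ hn, ← div_le_iff₀' (by positivity)]; exact hn1.le
  have hnη : Real.exp (1 / (2 * n)) ≤ 1 + η := by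
    rw [← Real.le_log_iff_exp_le (by linarith)]
    rw [div_lt_iff₀ (by positivity)] at hn2
    rw [div_le_iff₀ (by positivity)]
    linarith
  have hj : n * (2 * W * Real.arctan (δ / ε)) = j := div_mul_cancel₀ _ hP.ne'
  have hphase : toothPhase δ ε W Real.pi = (m * p : ℕ) * P := by
    rw [← hK, toothPhase_nat_mul hδ hε]
  have hstek := le_steklovN_teeth hδ hK hε hη hεδ hW hn hWη hnη hnε hj hk
  have hlip : LipschitzWith (W * (2 / ε)).toNNReal (toothProfile δ ε W n) :=
    lipschitzWith_toothProfile hε hW hn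
  have hper := toothProfile_periodic hδ hε hj
  have hmem : MemFrakDp p (toC ⁻¹' starDom (toothProfile δ ε W n)) := by
    refine memFrakDp_starDom hp ?_ hlip (toothProfile_nonneg hn) (toothProfile_le hn)
      (toothProfile_neg hδ) ?_ ?_
    · have := hper m
      have he : (m : ℝ) * (2 * δ) = 2 * Real.pi / p := by rw [hδd]; field_simp
      rwa [he] at this
    · have := toothProfile_nat_mul hδ hε hj 0
      simpa using this
    · have := toothProfile_nat_mul hδ hε hj (m * p)
      rwa [hK] at this
  have hp2 : Function.Periodic (toothProfile δ ε W n) (2 * Real.pi) := by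
    have := hper (m * p)
    rwa [mul_left_comm, hK] at this
  have hlen := teeth_length (M := m * p * j) hε hn (δ := δ) (W := W) (by
    rw [hphase, mul_left_comm, hj]; push_cast; ring)
  rw [← upper_frontier_starDom hlip.continuous hp2 (toothProfile_nonneg hn)] at hlen
  refine le_trans ?_ (le_iSup₂_of_le _ hmem (mul_le_mul' hstek hlen))
  rw [← ENNReal.ofReal_mul (by positivity)]
  refine ENNReal.ofReal_le_ofReal ?_
  have hcalc : 1 / ((1 + η) ^ 2 * (1 + 2 * η) * W) * toothPhase δ ε W Real.pi =
      2 * (m * p) * Real.arctan (δ / ε) / ((1 + η) ^ 2 * (1 + 2 * η)) := by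
    rw [hphase, hPd]; push_cast; field_simp
  rw [hcalc]
  gcongr

lemma lt_SfrakP {p m k : ℕ} (hp : p ≠ 0) (hm : m ≠ 0) (hk : (m * p + 1) / 2 ≤ k) {c : ℝ}
    (hc0 : 0 ≤ c) (hc : c < m * p * Real.pi) : ENNReal.ofReal c < SfrakP p k := by
  have hlim : Tendsto (fun η : ℝ => 2 * (m * p) * Real.arctan (2 * η⁻¹) /
      ((1 + η) ^ 2 * (1 + 2 * η))) (𝓝[>] 0) (𝓝 (m * p * Real.pi)) := by
    have h1 : Tendsto (fun η : ℝ => Real.arctan (2 * η⁻¹)) (𝓝[>] 0) (𝓝 (Real.pi / 2)) :=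
      (Real.tendsto_arctan_atTop.mono_right nhdsWithin_le_nhds).comp
        (tendsto_inv_nhdsGT_zero.const_mul_atTop two_pos)
    have h2 : Tendsto (fun η : ℝ => (1 + η) ^ 2 * (1 + 2 * η)) (𝓝[>] 0) (𝓝 1) := by
      have : Continuous fun η : ℝ => (1 + η) ^ 2 * (1 + 2 * η) := by fun_prop
      have h3 := (this.tendsto 0).mono_left (nhdsWithin_le_nhds (s := Ioi 0))
      simpa using h3
    have h4 := (h1.const_mul (2 * (m * p : ℝ))).div h2 one_ne_zero
    have h5 : 2 * (m * p : ℝ) * (Real.pi / 2) / 1 = m * p * Real.pi := by ring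
    rwa [h5] at h4
  obtain ⟨η, hηc, hη⟩ := ((hlim.eventually (lt_mem_nhds hc)).and self_mem_nhdsWithin).exists
  refine lt_of_lt_of_le ?_ (le_SfrakP_of_teeth hp hm hk hη)
  exact (ENNReal.ofReal_lt_ofReal_iff (lt_of_le_of_lt hc0 hηc)).2 hηc

theorem statement14 (p : ℕ) (hp : 2 ≤ p) :
    (∀ k : ℕ, (p + 1) / 2 ≤ k → ENNReal.ofReal ((p : ℝ) * Real.pi / 2) < SfrakP p k)
    ∧ (∀ k : ℕ, 2 * ((p + 1) / 2) ≤ k →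
        ENNReal.ofReal (((k / ((p + 1) / 2) : ℕ) - (1 / 2 : ℝ)) * p * Real.pi)
          ≤ SfrakP p k) := by
  have hp0 : (0 : ℝ) < p * Real.pi := mul_pos (by positivity) Real.pi_pos
  refine ⟨fun k hk => ?_, fun k hk => ?_⟩
  · exact lt_SfrakP (m := 1) (by omega) one_ne_zero (by omega) (by linarith)
      (by push_cast; linarith)
  · set q := (p + 1) / 2 with hq
    have hq1 : 1 ≤ q := by omega
    have hm2 : 2 ≤ k / q := (Nat.le_div_iff_mul_le (by omega)).2 hk
    have hmr : (2 : ℝ) ≤ (k / q : ℕ) := by exact_mod_cast hm2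
    refine (lt_SfrakP (m := k / q) (by omega) (by omega) ?_ ?_ ?_).le
    · have h1 : k / q * q ≤ k := Nat.div_mul_le_self k q
      have h2 : k / q * p ≤ k / q * (2 * q) := Nat.mul_le_mul_left _ (by omega)
      have h3 : k / q * (2 * q) = 2 * (k / q * q) := by ring
      omega
    · have : (0 : ℝ) ≤ (k / q : ℕ) - 1 / 2 := by linarith
      rw [mul_assoc]
      positivity
    · rw [mul_assoc, mul_assoc]
      exact mul_lt_mul_of_pos_right (by linarith) hp0

end
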